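/- arXiv:1702.00516 — 2 statements merged into one kernel-verified Lean document; each statement's English description precedes it below -/
import Mathlib

section
/- Let k be a p-adic field and let E/k be a finite field extension such that every field extension of k of degree p admits a k-embedding into E. Let D be a central division algebra of degree p over E. Then there exist finitely many finite field extensions M₁, ..., M_r of k such that for each i the algebra D ⊗_E (M_i ⊗_k E) is split (its base change to each field factor of M_i ⊗_k E is a matrix algebra) and gcd([M₁ : k], ..., [M_r : k]) = p. (This expresses that the corresponding torsor under R_{E/k}(PGL_p) admits a zero-cycle of degree p.) -/
open scoped TensorProduct
open Module

set_option synthInstance.maxHeartbeats 400000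
set_option maxHeartbeats 800000

/-- The central simple algebra `D` of degree `p` over `E` is split over `M ⊗_k E`, i.e. its
base change to every field factor `F` of the étale `E`-algebra `M ⊗_k E` is a matrix algebra;
field factors are encoded as fields `F` receiving `M` and `E` compatibly over `k` with the
induced map `M ⊗[k] E → F` surjective. -/
def CSASplitsOver (k E : Type) [Field k] [Field E] [Algebra k E]
    (D : Type) [Ring D] [Algebra E D] (p : ℕ)
    (M : Type) [Field M] [Algebra k M] : Prop :=
  ∀ (F : Type) [Field F] [Algebra k F] [Algebra M F] [Algebra E F]
    [IsScalarTower k M F] [IsScalarTower k E F],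
    Function.Surjective (Algebra.TensorProduct.productMap
      (IsScalarTower.toAlgHom k M F) (IsScalarTower.toAlgHom k E F)) →
    Nonempty ((F ⊗[E] D) ≃ₐ[F] Matrix (Fin p) (Fin p) F)

universe u v w

/-- A locally compact, non-discrete, ultrametric normed division ring. -/
class IsLocalDivisionRing (A : Type*) [NormedDivisionRing A] : Prop extends
    IsUltrametricDist A, ProperSpace A where
  exists_norm_lt_one : ∃ x : A, x ≠ 0 ∧ ‖x‖ < 1

namespace LocalDivisionRing

section Basic

variable (A : Type*) [NormedDivisionRing A] [IsLocalDivisionRing A]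

/-- The subring of integers of an ultrametric normed division ring. -/
def integers : Subring A where
  carrier := {x | ‖x‖ ≤ 1}
  mul_mem' {a b} ha hb := by
    simpa using mul_le_one₀ (show ‖a‖ ≤ 1 from ha) (norm_nonneg b) hb
  one_mem' := by simp
  add_mem' {a b} ha hb := (IsUltrametricDist.norm_add_le_max a b).trans (max_le ha hb)
  zero_mem' := by simp
  neg_mem' {a} ha := by simpa using ha

/-- The maximal ideal of the ring of integers. -/
def maxIdeal : Ideal (integers A) where
  carrier := {x | ‖(x : A)‖ < 1}
  add_mem' {a b} ha hb := (IsUltrametricDist.norm_add_le_max (a : A) b).trans_lt (max_lt ha hb)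
  zero_mem' := by simp
  smul_mem' c x hx := by
    simpa using mul_lt_one_of_nonneg_of_lt_one_right c.2 (norm_nonneg _) hx

instance : (maxIdeal A).IsTwoSided where
  mul_mem_of_left {a} b ha := by
    change ‖((a * b : integers A) : A)‖ < 1
    simpa using mul_lt_one_of_nonneg_of_lt_one_left (norm_nonneg _) ha b.2

/-- The residue ring of an ultrametric normed division ring. -/
abbrev Residue : Type _ := integers A ⧸ maxIdeal A

variable {A}

/-- The residue class of an integral element. -/
def res (x : A) (hx : ‖x‖ ≤ 1) : Residue A := Ideal.Quotient.mk (maxIdeal A) ⟨x, hx⟩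

theorem exists_res (y : Residue A) : ∃ (x : A) (hx : ‖x‖ ≤ 1), res x hx = y := by
  obtain ⟨⟨x, hx⟩, rfl⟩ := Ideal.Quotient.mk_surjective y
  exact ⟨x, hx, rfl⟩

theorem res_eq_res {x y : A} {hx : ‖x‖ ≤ 1} {hy : ‖y‖ ≤ 1} :
    res x hx = res y hy ↔ ‖x - y‖ < 1 := Ideal.Quotient.eq

theorem res_eq_zero {x : A} {hx : ‖x‖ ≤ 1} : res x hx = 0 ↔ ‖x‖ < 1 :=
  Ideal.Quotient.eq_zero_iff_mem

instance : IsDomain (Residue A) := by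
  have : Nontrivial (Residue A) := ⟨⟨res 1 (by simp), 0, by simp [res_eq_zero]⟩⟩
  have : NoZeroDivisors (Residue A) := by
    refine ⟨fun {a b} h ↦ ?_⟩
    obtain ⟨x, hx, rfl⟩ := exists_res a
    obtain ⟨y, hy, rfl⟩ := exists_res b
    have h' : ‖x * y‖ < 1 := res_eq_zero (hx := by
      simpa using mul_le_one₀ hx (norm_nonneg y) hy).1 h
    rw [res_eq_zero, res_eq_zero]
    by_contra! hc
    rw [norm_mul, le_antisymm hx hc.1, le_antisymm hy hc.2] at h'
    norm_num at h'
  exact NoZeroDivisors.to_isDomain _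

instance : Finite (Residue A) := by
  have hc : IsCompact (Metric.closedBall (0 : A) 1) := isCompact_closedBall 0 1
  obtain ⟨t, ht, hcov⟩ := hc.elim_nhds_subcover (fun x ↦ Metric.ball x 1)
    fun x _ ↦ Metric.ball_mem_nhds x one_pos
  have ht' : ∀ x ∈ t, ‖x‖ ≤ 1 := fun x hx ↦ by simpa using ht x hx
  refine Finite.of_surjective (fun x : t ↦ res (x : A) (ht' x x.2)) fun y ↦ ?_
  obtain ⟨x, hx, rfl⟩ := exists_res y
  have := hcov (show x ∈ Metric.closedBall (0 : A) 1 by simpa using hx)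
  simp only [Set.mem_iUnion, Metric.mem_ball, dist_eq_norm] at this
  obtain ⟨z, hz, hxz⟩ := this
  exact ⟨⟨z, hz⟩, (res_eq_res.2 hxz).symm⟩

theorem residue_isField : IsField (Residue A) := Finite.isDomain_to_isField _

theorem norm_mul_sub_mul_lt_one {x y : A} (hx : ‖x‖ ≤ 1) (hy : ‖y‖ ≤ 1) :
    ‖x * y - y * x‖ < 1 :=
  res_eq_res (hx := by simpa using mul_le_one₀ hx (norm_nonneg y) hy)
    (hy := by simpa using mul_le_one₀ hy (norm_nonneg x) hx) |>.1
      (residue_isField.mul_comm (res x hx) (res y hy))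

variable (A) in
theorem exists_uniformizer :
    ∃ ϖ : A, ϖ ≠ 0 ∧ ‖ϖ‖ < 1 ∧ ∀ x : A, ‖x‖ < 1 → ‖x‖ ≤ ‖ϖ‖ := by
  have hc : IsCompact (Metric.ball (0 : A) 1) :=
    Metric.isCompact_of_isClosed_isBounded (IsUltrametricDist.isClosed_ball 0 1)
      Metric.isBounded_ball
  obtain ⟨ϖ, h1, h2⟩ := hc.exists_isMaxOn ⟨0, by simp⟩ continuous_norm.continuousOn
  have h2' : ∀ x : A, ‖x‖ < 1 → ‖x‖ ≤ ‖ϖ‖ := fun x hx ↦ h2 (by simpa using hx)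
  refine ⟨ϖ, ?_, by simpa using h1, h2'⟩
  rintro rfl
  obtain ⟨x, hx0, hx⟩ := IsLocalDivisionRing.exists_norm_lt_one (A := A)
  exact hx0 (by simpa using h2' x hx)

variable (A) in
/-- A chosen uniformizer. -/
noncomputable def ϖ : A := (exists_uniformizer A).choose

theorem ϖ_ne_zero : ϖ A ≠ 0 := (exists_uniformizer A).choose_spec.1

theorem norm_ϖ_pos : 0 < ‖ϖ A‖ := norm_pos_iff.2 ϖ_ne_zero

theorem norm_ϖ_lt_one : ‖ϖ A‖ < 1 := (exists_uniformizer A).choose_spec.2.1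

theorem norm_le_norm_ϖ {x : A} (hx : ‖x‖ < 1) : ‖x‖ ≤ ‖ϖ A‖ :=
  (exists_uniformizer A).choose_spec.2.2 x hx

theorem exists_norm_eq_zpow {x : A} (hx : x ≠ 0) : ∃ k : ℤ, ‖x‖ = ‖ϖ A‖ ^ k := by
  obtain ⟨n, h1, h2⟩ := exists_mem_Ioc_zpow (norm_pos_iff.2 hx)
    ((one_lt_inv₀ (norm_ϖ_pos (A := A))).2 norm_ϖ_lt_one)
  have hpos : 0 < ‖ϖ A‖ ^ (n + 1) := zpow_pos norm_ϖ_pos _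
  refine ⟨-(n + 1), ?_⟩
  rw [inv_zpow] at h1 h2
  rw [zpow_neg]
  refine le_antisymm h2 (not_lt.1 fun h ↦ ?_)
  have h3 : ‖x * ϖ A ^ (n + 1)‖ < 1 := by
    rw [norm_mul, norm_zpow]
    rwa [lt_inv_comm₀ (norm_pos_iff.2 hx) hpos, ← one_div, lt_div_iff₀ (norm_pos_iff.2 hx),
      mul_comm] at h
  have h4 := norm_le_norm_ϖ h3
  rw [norm_mul, norm_zpow, zpow_add_one₀ norm_ϖ_pos.ne', ← mul_assoc] at h4
  have h5 : ‖x‖ * ‖ϖ A‖ ^ n ≤ 1 := le_of_mul_le_mul_right (by simpa using h4) norm_ϖ_pos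
  rw [inv_lt_iff_one_lt_mul₀ (zpow_pos norm_ϖ_pos _)] at h1
  linarith

theorem zpow_norm_ϖ_inj {k l : ℤ} : ‖ϖ A‖ ^ k = ‖ϖ A‖ ^ l ↔ k = l :=
  zpow_right_inj₀ norm_ϖ_pos norm_ϖ_lt_one.ne

variable (A) in
/-- The cardinality of the residue field. -/
noncomputable def q : ℕ := Nat.card (Residue A)

theorem one_lt_q : 1 < q A := Finite.one_lt_card

theorem res_natCast (n : ℕ) : (n : Residue A) = 0 ↔ ‖(n : A)‖ < 1 := by
  have : (n : Residue A) = Ideal.Quotient.mk (maxIdeal A) (n : integers A) := by simp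
  rw [this, Ideal.Quotient.eq_zero_iff_mem]
  change ‖((n : integers A) : A)‖ < 1 ↔ _
  simp

theorem norm_q_lt_one : ‖(q A : A)‖ < 1 := by
  rw [← res_natCast]
  have := Fintype.ofFinite (Residue A)
  rw [q, Nat.card_eq_fintype_card]
  exact Nat.cast_card_eq_zero _

theorem norm_pow_q_sub_self_lt {x : A} (hx : ‖x‖ ≤ 1) : ‖x ^ q A - x‖ < 1 := by
  refine res_eq_res (hx := by simpa using pow_le_one₀ (norm_nonneg x) hx) (hy := hx) |>.1 ?_
  let := (residue_isField (A := A)).toField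
  have := Fintype.ofFinite (Residue A)
  have h := FiniteField.pow_card (res x hx)
  rw [← Nat.card_eq_fintype_card] at h
  exact h

theorem norm_pow_sub_pow_lt {x y : A} (hxy : Commute x y) (hx : ‖x‖ ≤ 1) (hy : ‖y‖ ≤ 1)
    (h : ‖x - y‖ < 1) (hne : x ≠ y) {n : ℕ} (hn : ‖(n : A)‖ < 1) :
    ‖x ^ n - y ^ n‖ < ‖x - y‖ := by
  rw [← hxy.mul_geom_sum₂, norm_mul]
  refine mul_lt_of_lt_one_right (norm_pos_iff.2 (sub_ne_zero.2 hne)) ?_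
  have e : ((∑ i ∈ Finset.range n, (⟨x, hx⟩ : integers A) ^ i * (⟨y, hy⟩ : integers A) ^ (n - 1 - i)
      : integers A) : A) = ∑ i ∈ Finset.range n, x ^ i * y ^ (n - 1 - i) := by
    simp
  rw [← e]
  refine Ideal.Quotient.eq_zero_iff_mem (I := maxIdeal A).1 ?_
  have hr : Ideal.Quotient.mk (maxIdeal A) ⟨x, hx⟩ = Ideal.Quotient.mk (maxIdeal A) ⟨y, hy⟩ :=
    res_eq_res.2 h
  rw [map_sum]
  simp only [map_mul, map_pow, hr, ← pow_add]
  rw [Finset.sum_congr rfl (g := fun _ ↦ Ideal.Quotient.mk (maxIdeal A) ⟨y, hy⟩ ^ (n - 1))]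
  · rw [Finset.sum_const, Finset.card_range, nsmul_eq_mul, (res_natCast n).2 hn, zero_mul]
  · intro i hi
    rw [Finset.mem_range] at hi
    congr 1
    omega

/-- Two commuting Teichmüller elements with the same residue are equal. -/
theorem teichmuller_unique {x y : A} (hxy : Commute x y) (hx : x ^ q A = x) (hy : y ^ q A = y)
    (h : ‖x - y‖ < 1) : x = y := by
  have norm_le : ∀ z : A, z ^ q A = z → ‖z‖ ≤ 1 := fun z hz ↦ by
    by_contra! hc
    have := congrArg norm hz
    rw [norm_pow] at this
    exact (lt_self_pow₀ hc one_lt_q).ne' this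
  by_contra hne
  have := norm_pow_sub_pow_lt hxy (norm_le x hx) (norm_le y hy) h hne norm_q_lt_one
  rw [hx, hy] at this
  exact lt_irrefl _ this

/-- Existence of Teichmüller representatives. -/
theorem exists_teichmuller {a : A} (ha : ‖a‖ ≤ 1) :
    ∃ w : A, w ^ q A = w ∧ ‖w - a‖ < 1 := by
  let S : Set A := {x | Commute x a} ∩ Metric.ball a 1
  have hS : IsCompact S := by
    refine Metric.isCompact_of_isClosed_isBounded (IsClosed.inter ?_
      (IsUltrametricDist.isClosed_ball a 1)) (Metric.isBounded_ball.subset Set.inter_subset_right)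
    exact isClosed_eq (continuous_id.mul continuous_const) (continuous_const.mul continuous_id)
  obtain ⟨w, ⟨hw1, hw2⟩, hmin⟩ := hS.exists_isMinOn (f := fun x ↦ ‖x ^ q A - x‖)
    ⟨a, Commute.refl a, by simp⟩ (by fun_prop)
  rw [Metric.mem_ball, dist_eq_norm] at hw2
  refine ⟨w, ?_, hw2⟩
  have hw : ‖w‖ ≤ 1 := by
    have := IsUltrametricDist.norm_add_le_max (w - a) a
    rw [sub_add_cancel] at this
    exact this.trans (max_le hw2.le ha)
  by_contra hne
  have hlt := norm_pow_q_sub_self_lt hw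
  have h1 := norm_pow_sub_pow_lt (Commute.pow_self w (q A))
    (by simpa using pow_le_one₀ (norm_nonneg w) hw) hw hlt hne norm_q_lt_one
  refine not_le.2 h1 (hmin ⟨Commute.pow_left hw1 _, ?_⟩)
  rw [Metric.mem_ball, dist_eq_norm, ← sub_add_sub_cancel _ w a]
  exact (IsUltrametricDist.norm_add_le_max _ _).trans_lt (max_lt hlt hw2)

/-- A subspace approximating every nonzero vector is everything. -/
theorem eq_top_of_approx {E : Type*} [NormedField E] [IsLocalDivisionRing E] [NormedAlgebra E A]
    [FiniteDimensional E A] (V : Submodule E A)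
    (h : ∀ d : A, d ≠ 0 → ∃ v ∈ V, ‖d - v‖ < ‖d‖) : V = ⊤ := by
  let : NontriviallyNormedField E :=
    { ‹NormedField E› with
      non_trivial := by
        obtain ⟨x, hx0, hx⟩ := IsLocalDivisionRing.exists_norm_lt_one (A := E)
        exact ⟨x⁻¹, by rw [norm_inv]; exact (one_lt_inv₀ (norm_pos_iff.2 hx0)).2 hx⟩ }
  have hcl : IsClosed (V : Set A) := V.closed_of_finiteDimensional
  rw [eq_top_iff]
  intro d _
  obtain ⟨v, hv, hd⟩ := hcl.exists_infDist_eq_dist ⟨0, V.zero_mem⟩ d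
  by_contra hdV
  have hne : d - v ≠ 0 := fun h0 ↦ hdV (by rwa [sub_eq_zero.1 h0])
  obtain ⟨v', hv', hlt⟩ := h _ hne
  have := Metric.infDist_le_dist_of_mem (x := d) (V.add_mem hv hv')
  rw [hd, dist_eq_norm, dist_eq_norm] at this
  rw [sub_sub] at hlt
  linarith

end Basic


theorem norm_sum_lt {A ι : Type*} [NormedDivisionRing A] [IsUltrametricDist A] (s : Finset ι)
    (f : ι → A) {C : ℝ} (hC : 0 < C) (h : ∀ i ∈ s, ‖f i‖ < C) : ‖∑ i ∈ s, f i‖ < C := by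
  classical
  induction s using Finset.induction_on with
  | empty => simpa
  | insert a s ha ih =>
    rw [Finset.sum_insert ha]
    exact (IsUltrametricDist.norm_add_le_max _ _).trans_lt (max_lt (h a (by simp))
      (ih fun i hi ↦ h i (by simp [hi])))

/-- A finite sum of vectors whose nonzero terms have distinct norms vanishes only trivially. -/
theorem eq_zero_of_sum_eq_zero {A ι : Type*} [NormedDivisionRing A] [IsUltrametricDist A]
    [Fintype ι] (f : ι → A) (hf : ∀ i j, f i ≠ 0 → f j ≠ 0 → ‖f i‖ = ‖f j‖ → i = j)
    (h : ∑ i, f i = 0) (i : ι) : f i = 0 := by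
  classical
  by_contra hi
  obtain ⟨m, -, hm⟩ := Finset.exists_max_image Finset.univ (fun i ↦ ‖f i‖) ⟨i, by simp⟩
  have hm0 : f m ≠ 0 := by
    have := hm i (by simp)
    have := norm_pos_iff.2 hi
    exact norm_pos_iff.1 (by linarith)
  rw [← Finset.add_sum_erase _ _ (Finset.mem_univ m)] at h
  have hlt : ‖∑ j ∈ Finset.univ.erase m, f j‖ < ‖f m‖ := by
    refine norm_sum_lt _ _ (norm_pos_iff.2 hm0) fun j hj ↦ ?_
    refine lt_of_le_of_ne (hm j (by simp)) fun he ↦ ?_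
    by_cases hj0 : f j = 0
    · rw [hj0, norm_zero] at he
      exact hm0 (norm_eq_zero.1 he.symm)
    · exact (Finset.ne_of_mem_erase hj) (hf j m hj0 hm0 he)
  rw [eq_neg_of_add_eq_zero_left h, norm_neg] at hlt
  exact lt_irrefl _ hlt

section Extension

variable (E A : Type*) [NormedField E] [IsLocalDivisionRing E] [NormedDivisionRing A]
  [IsLocalDivisionRing A] [NormedAlgebra E A]

/-- The map on rings of integers induced by an extension. -/
def integersMap : integers E →+* integers A :=
  (algebraMap E A).restrict (integers E) (integers A) fun x hx ↦ by
    change ‖algebraMap E A x‖ ≤ 1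
    rwa [norm_algebraMap']

/-- The map on residue rings induced by an extension. -/
def residueMap : Residue E →+* Residue A :=
  Ideal.quotientMap (maxIdeal A) (integersMap E A) fun x hx ↦ by
    change ‖algebraMap E A x‖ < 1
    rwa [norm_algebraMap']

variable {E A} in
theorem res_sum {ι : Type*} [Fintype ι] (c : ι → integers E) (b : ι → integers A) :
    Ideal.Quotient.mk (maxIdeal A) (∑ i, integersMap E A (c i) * b i) =
      ∑ i, residueMap E A (Ideal.Quotient.mk (maxIdeal E) (c i)) *
        Ideal.Quotient.mk (maxIdeal A) (b i) := by
  rw [map_sum]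
  rfl

/-- The fundamental identity `n = e f`. -/
theorem exists_ramification_inertia [FiniteDimensional E A] :
    ∃ e f : ℕ, ‖ϖ A‖ ^ e = ‖ϖ E‖ ∧ q A = q E ^ f ∧ finrank E A = e * f := by
  have hE0 : algebraMap E A (ϖ E) ≠ 0 := by simpa using ϖ_ne_zero (A := E)
  obtain ⟨k, hk⟩ := exists_norm_eq_zpow hE0
  rw [norm_algebraMap'] at hk
  have hkpos : 0 < k := by
    by_contra! hc
    have := one_le_zpow_of_nonpos₀ (norm_ϖ_pos (A := A)) norm_ϖ_lt_one.le hc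
    rw [← hk] at this
    exact not_lt.2 this norm_ϖ_lt_one
  lift k to ℕ using hkpos.le with e
  rw [zpow_natCast] at hk
  have he : 0 < e := by exact_mod_cast hkpos
  let _ : Field (Residue E) := (residue_isField (A := E)).toField
  let _ : Module (Residue E) (Residue A) := Module.compHom _ (residueMap E A)
  have smul_def : ∀ (x : Residue E) (y : Residue A), x • y = residueMap E A x * y :=
    fun _ _ ↦ rfl
  have : Module.Finite (Residue E) (Residue A) := Module.Finite.of_finite
  let b := Module.finBasis (Residue E) (Residue A)
  set f := finrank (Residue E) (Residue A)
  have hcard : q A = q E ^ f := Module.natCard_eq_pow_finrank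
  choose B hB using fun i ↦ Ideal.Quotient.mk_surjective (I := maxIdeal A) (b i)
  have hcomb : ∀ c : Fin f → E, (∃ i, c i ≠ 0) →
      ∃ i, c i ≠ 0 ∧ ‖∑ i, c i • (B i : A)‖ = ‖c i‖ := by
    rintro c ⟨i, hi⟩
    obtain ⟨m, -, hm⟩ := Finset.exists_max_image Finset.univ (fun i ↦ ‖c i‖) ⟨i, by simp⟩
    have hm0 : c m ≠ 0 := by
      have := hm i (by simp)
      have := norm_pos_iff.2 hi
      exact norm_pos_iff.1 (by linarith)
    refine ⟨m, hm0, ?_⟩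
    let c' : Fin f → integers E := fun i ↦ ⟨(c m)⁻¹ * c i, by
      change ‖(c m)⁻¹ * c i‖ ≤ 1
      rw [norm_mul, norm_inv, inv_mul_le_one₀ (norm_pos_iff.2 hm0)]
      exact hm i (by simp)⟩
    have hs : ((∑ i, integersMap E A (c' i) * B i : integers A) : A) =
        (c m)⁻¹ • ∑ i, c i • (B i : A) := by
      rw [AddSubmonoidClass.coe_finsetSum, Finset.smul_sum]
      refine Finset.sum_congr rfl fun i _ ↦ ?_
      rw [smul_smul, Algebra.smul_def]
      rfl
    have hne : ¬ ‖((∑ i, integersMap E A (c' i) * B i : integers A) : A)‖ < 1 := by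
      intro hlt
      have h0 := Ideal.Quotient.eq_zero_iff_mem (I := maxIdeal A).2 hlt
      rw [res_sum] at h0
      simp only [hB, ← smul_def] at h0
      have := Fintype.linearIndependent_iff.1 b.linearIndependent _ h0 m
      have h1 : c' m = 1 := Subtype.ext (inv_mul_cancel₀ hm0)
      rw [h1, map_one] at this
      exact one_ne_zero this
    have h1 := le_antisymm (∑ i, integersMap E A (c' i) * B i : integers A).2 (not_lt.1 hne)
    rw [hs, norm_smul, norm_inv] at h1
    exact (inv_mul_eq_one₀ (norm_ne_zero_iff.2 hm0)).1 h1 |>.symm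
  let v : Fin e × Fin f → A := fun ij ↦ (B ij.2 : A) * ϖ A ^ (ij.1 : ℕ)
  have hli : LinearIndependent E v := by
    rw [Fintype.linearIndependent_iff]
    intro g hg
    rw [Fintype.sum_prod_type] at hg
    let y : Fin e → A := fun j ↦ (∑ i, g (j, i) • (B i : A)) * ϖ A ^ (j : ℕ)
    have hy : ∀ j, (∃ i, g (j, i) ≠ 0) → ∃ l : ℤ, y j ≠ 0 ∧ ‖y j‖ = ‖ϖ A‖ ^ (e * l + j : ℤ) := by
      intro j hj
      obtain ⟨i, hi, hn⟩ := hcomb (fun i ↦ g (j, i)) hj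
      obtain ⟨l, hl⟩ := exists_norm_eq_zpow hi
      have : ‖y j‖ = ‖ϖ A‖ ^ (e * l + j : ℤ) := by
        rw [norm_mul, hn, hl, hk, norm_pow, zpow_add₀ norm_ϖ_pos.ne', zpow_mul, zpow_natCast,
          zpow_natCast]
      exact ⟨l, norm_pos_iff.1 (this ▸ zpow_pos norm_ϖ_pos _), this⟩
    have hy' : ∀ j, y j ≠ 0 → ∃ i, g (j, i) ≠ 0 := by
      intro j hj
      by_contra! hc
      exact hj (by simp [y, hc])
    have hsum : ∑ j, y j = 0 := by
      rw [← hg]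
      refine Finset.sum_congr rfl fun j _ ↦ ?_
      simp [y, v, Finset.sum_mul]
    have hz := eq_zero_of_sum_eq_zero y (fun i j hi hj hij ↦ by
      obtain ⟨l, -, hl⟩ := hy i (hy' i hi)
      obtain ⟨l', -, hl'⟩ := hy j (hy' j hj)
      rw [hl, hl', zpow_norm_ϖ_inj] at hij
      have h1 := congrArg (· % (e : ℤ)) hij
      simp only [Int.mul_add_emod_self_left] at h1
      rw [Int.emod_eq_of_lt (by positivity) (by exact_mod_cast i.2),
        Int.emod_eq_of_lt (by positivity) (by exact_mod_cast j.2)] at h1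
      exact Fin.ext (by exact_mod_cast h1)) hsum
    rintro ⟨j, i⟩
    by_contra hji
    obtain ⟨l, h, -⟩ := hy j ⟨i, hji⟩
    exact h (hz j)
  have hsp : Submodule.span E (Set.range v) = ⊤ := by
    refine eq_top_of_approx _ fun d hd ↦ ?_
    obtain ⟨k, hdk⟩ := exists_norm_eq_zpow hd
    have hk' : k = e * (k / e) + (k % e).toNat := by
      rw [Int.toNat_of_nonneg (Int.emod_nonneg _ (by omega)), Int.mul_ediv_add_emod]
    have hj : (k % e).toNat < e := by
      have := Int.emod_lt_of_pos k (show (0 : ℤ) < e by omega)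
      omega
    generalize (k % e).toNat = j at hk' hj
    generalize k / e = m at hk'
    have hpm : ϖ E ^ m ≠ 0 := zpow_ne_zero _ ϖ_ne_zero
    have hpj : ϖ A ^ j ≠ 0 := pow_ne_zero _ ϖ_ne_zero
    have hdn : ‖d‖ = ‖ϖ E ^ m‖ * ‖ϖ A ^ j‖ := by
      rw [hdk, hk', norm_zpow, hk, norm_pow, zpow_add₀ norm_ϖ_pos.ne', zpow_mul,
        zpow_natCast, zpow_natCast]
    let u : A := (ϖ E ^ m)⁻¹ • (d * (ϖ A ^ j)⁻¹)
    have hu : ‖u‖ ≤ 1 := by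
      rw [norm_smul, norm_mul, hdn, norm_inv, norm_inv]
      have := norm_ne_zero_iff.2 hpm
      have := norm_ne_zero_iff.2 hpj
      apply le_of_eq
      field_simp
    choose α hα using fun i ↦ Ideal.Quotient.mk_surjective (I := maxIdeal E)
      (b.repr (res u hu) i)
    have hlt : ‖u - ∑ i, (α i : E) • (B i : A)‖ < 1 := by
      have h1 : Ideal.Quotient.mk (maxIdeal A) ⟨u, hu⟩ =
          Ideal.Quotient.mk (maxIdeal A) (∑ i, integersMap E A (α i) * B i) := by
        rw [res_sum]
        simp only [hα, hB, ← smul_def]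
        exact (b.sum_repr _).symm
      have h2 : ((∑ i, integersMap E A (α i) * B i : integers A) : A) =
          ∑ i, (α i : E) • (B i : A) := by
        rw [AddSubmonoidClass.coe_finsetSum]
        refine Finset.sum_congr rfl fun i _ ↦ ?_
        rw [Algebra.smul_def]
        rfl
      rw [← h2]
      exact Ideal.Quotient.eq.1 h1
    refine ⟨ϖ E ^ m • ((∑ i, (α i : E) • (B i : A)) * ϖ A ^ j), ?_, ?_⟩
    · rw [Finset.sum_mul]
      refine Submodule.smul_mem _ _ (Submodule.sum_mem _ fun i _ ↦ ?_)
      rw [smul_mul_assoc]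
      exact Submodule.smul_mem _ _ (Submodule.subset_span ⟨(⟨j, hj⟩, i), rfl⟩)
    · have h3 : d - ϖ E ^ m • ((∑ i, (α i : E) • (B i : A)) * ϖ A ^ j) =
          ϖ E ^ m • ((u - ∑ i, (α i : E) • (B i : A)) * ϖ A ^ j) := by
        rw [sub_mul, smul_sub, smul_mul_assoc, smul_inv_smul₀ hpm, mul_assoc, inv_mul_cancel₀ hpj,
          mul_one]
      rw [h3, norm_smul, norm_mul, hdn]
      have := norm_pos_iff.2 hpm
      have := norm_pos_iff.2 hpj
      have : ‖u - ∑ i, (α i : E) • (B i : A)‖ * ‖ϖ A ^ j‖ < 1 * ‖ϖ A ^ j‖ := by gcongr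
      rw [one_mul] at this
      gcongr
  refine ⟨e, f, hk.symm, hcard, ?_⟩
  rw [Module.finrank_eq_card_basis (Basis.mk hli hsp.ge)]
  simp

end Extension


section Generator

variable {A : Type*} [NormedDivisionRing A] [IsLocalDivisionRing A]

theorem norm_eq_one_of_pow_q {w : A} (hw : w ^ q A = w) (hw0 : w ≠ 0) : ‖w‖ = 1 := by
  have h : ‖w‖ ^ (q A - 1) = 1 := by
    rw [← norm_pow, pow_sub₀ w hw0 one_lt_q.le, hw, pow_one, mul_inv_cancel₀ hw0, norm_one]
  exact (pow_eq_one_iff_of_nonneg (norm_nonneg w) (Nat.sub_pos_of_lt one_lt_q).ne').1 h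

variable (A) in
/-- There is a root of unity generating the multiplicative group of the residue field. -/
theorem exists_generator :
    ∃ w : A, w ≠ 0 ∧ w ^ q A = w ∧ orderOf w = q A - 1 ∧
      ∀ a : A, ‖a‖ = 1 → ∃ n : ℕ, ‖a - w ^ n‖ < 1 := by
  let _ : Field (Residue A) := (residue_isField (A := A)).toField
  have := Fintype.ofFinite (Residue A)
  obtain ⟨g, hg⟩ := IsCyclic.exists_monoid_generator (α := (Residue A)ˣ)
  obtain ⟨a, ha, hag⟩ := exists_res (g : Residue A)
  obtain ⟨w, hw, hwa⟩ := exists_teichmuller ha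
  have hres : ∀ hw1 : ‖w‖ ≤ 1, res w hw1 = g := fun hw1 ↦ by rw [← hag, res_eq_res]; exact hwa
  have hw0 : w ≠ 0 := by
    rintro rfl
    refine g.ne_zero ?_
    rw [← hres (by simp), res_eq_zero]
    simp
  have hw1 := norm_eq_one_of_pow_q hw hw0
  have hres' := hres hw1.le
  have hpow : ∀ n : ℕ, ‖w ^ n‖ ≤ 1 := fun n ↦ by simp [hw1]
  have hrespow : ∀ n : ℕ, res (w ^ n) (hpow n) = (g : Residue A) ^ n := fun n ↦ by
    rw [← hres']; rfl
  have hwq : w ^ (q A - 1) = 1 := by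
    rw [pow_sub₀ w hw0 one_lt_q.le, hw, pow_one, mul_inv_cancel₀ hw0]
  refine ⟨w, hw0, hw, ?_, fun a ha ↦ ?_⟩
  · have hord : orderOf g = q A - 1 := by
      rw [orderOf_eq_card_of_forall_mem_powers hg, Nat.card_units]
      rfl
    refine Nat.dvd_antisymm (orderOf_dvd_of_pow_eq_one hwq) ?_
    rw [← hord]
    refine orderOf_dvd_of_pow_eq_one (Units.ext ?_)
    push_cast
    rw [← hrespow]
    simp only [pow_orderOf_eq_one]
    rfl
  · have hne : res a ha.le ≠ 0 := by
      rw [Ne, res_eq_zero, ha]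
      exact lt_irrefl _
    obtain ⟨n, hn⟩ := hg (Units.mk0 _ hne)
    refine ⟨n, ?_⟩
    rw [← res_eq_res (hx := ha.le) (hy := hpow n), hrespow, ← Units.val_pow_eq_pow_val]
    exact (congrArg Units.val hn).symm

theorem exists_approx {w x : A} (hw : ∀ a : A, ‖a‖ = 1 → ∃ n : ℕ, ‖a - w ^ n‖ < 1)
    (hx : ‖x‖ = ‖ϖ A‖) {d : A} (hd : d ≠ 0) :
    ∃ (n : ℕ) (k : ℤ), ‖d - w ^ n * x ^ k‖ < ‖d‖ := by
  obtain ⟨k, hk⟩ := exists_norm_eq_zpow hd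
  have hx0 : x ≠ 0 := norm_pos_iff.1 (hx ▸ norm_ϖ_pos)
  have hxk : x ^ k ≠ 0 := zpow_ne_zero _ hx0
  have hdx : ‖d‖ = ‖x ^ k‖ := by rw [hk, norm_zpow, hx]
  obtain ⟨n, hn⟩ := hw (d * (x ^ k)⁻¹) (by
    rw [norm_mul, norm_inv, hdx, mul_inv_cancel₀ (norm_ne_zero_iff.2 hxk)])
  refine ⟨n, k, ?_⟩
  have : d - w ^ n * x ^ k = (d * (x ^ k)⁻¹ - w ^ n) * x ^ k := by
    rw [sub_mul, mul_assoc, inv_mul_cancel₀ hxk, mul_one]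
  rw [this, norm_mul, hdx]
  exact mul_lt_of_lt_one_left (norm_pos_iff.2 hxk) hn

/-- A noncentral Teichmüller element acts nontrivially by conjugation on some graded piece. -/
theorem exists_norm_commutator {w : A} (hw0 : w ≠ 0) (hw : w ^ q A = w)
    (hc : ∃ x, w * x ≠ x * w) : ∃ x, x ≠ 0 ∧ ‖x‖ ≤ ‖w * x - x * w‖ := by
  by_contra! H
  obtain ⟨x, hx⟩ := hc
  have hw1 := norm_eq_one_of_pow_q hw hw0
  set y := w * x - x * w with hy
  have hy0 : y ≠ 0 := sub_ne_zero.2 hx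
  have key : ∀ n : ℕ, ‖w * (w ^ n * x - x * w ^ n) - n * (y * w ^ n)‖ < ‖y‖ := by
    intro n
    induction n with
    | zero => simpa using hy0
    | succ n ih =>
      have e : w * (w ^ (n + 1) * x - x * w ^ (n + 1)) - (n + 1 : ℕ) * (y * w ^ (n + 1)) =
          w * (w * (w ^ n * x - x * w ^ n) - n * (y * w ^ n)) +
            (n + 1 : ℕ) * ((w * y - y * w) * w ^ n) := by
        have h1 : w * ((n : A) * (y * w ^ n)) = (n : A) * (w * y * w ^ n) := by
          rw [← mul_assoc, ← (Nat.cast_commute n w).eq]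
          simp only [mul_assoc]
        have h2 : w * (x * w ^ (n + 1)) = w * x * w ^ n * w := by
          rw [pow_succ]; simp only [mul_assoc]
        have h3 : w * (w ^ (n + 1) * x) = w * (w * (w ^ n * x)) := by
          rw [pow_succ']; simp only [mul_assoc]
        have h4 : w * (w * (x * w ^ n)) = w * (y * w ^ n) + w * (x * w ^ (n + 1)) := by
          rw [hy, pow_succ']; simp only [mul_assoc, sub_mul, mul_sub]; abel
        rw [mul_sub w, mul_sub w, mul_sub w, mul_sub w, h1, h3, h4, pow_succ' w n]
        push_cast
        simp only [add_mul, sub_mul, mul_sub, one_mul, mul_assoc]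
        abel
      rw [e]
      refine (IsUltrametricDist.norm_add_le_max _ _).trans_lt (max_lt ?_ ?_)
      · rwa [norm_mul, hw1, one_mul]
      · rw [norm_mul, norm_mul, norm_pow, hw1, one_pow, mul_one]
        exact (mul_le_of_le_one_left (norm_nonneg _)
          (IsUltrametricDist.norm_natCast_le_one A _)).trans_lt (H y hy0)
  have h := key (q A)
  rw [hw, ← hy] at h
  have h2 : ‖(q A : A) * (y * w)‖ < ‖y‖ := by
    rw [norm_mul, norm_mul, hw1, mul_one]
    exact mul_lt_of_lt_one_left (norm_pos_iff.2 hy0) norm_q_lt_one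
  have h3 := (IsUltrametricDist.norm_add_le_max _ _).trans_lt (max_lt h h2)
  rw [sub_add_cancel, norm_mul, hw1, one_mul] at h3
  exact lt_irrefl _ h3

end Generator

section Central

variable {E D : Type*} [NormedField E] [IsLocalDivisionRing E] [NormedDivisionRing D]
  [IsLocalDivisionRing D] [NormedAlgebra E D]

theorem exists_teichmuller_of_q_eq (h : q D = q E) {w : D} (hw : w ^ q D = w) :
    ∃ c : E, algebraMap E D c = w := by
  by_cases hw0 : w = 0
  · exact ⟨0, by simp [hw0]⟩
  have hw1 := norm_eq_one_of_pow_q hw hw0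
  let _ : Field (Residue E) := (residue_isField (A := E)).toField
  have hbij : Function.Bijective (residueMap E D) :=
    (residueMap E D).injective.bijective_of_nat_card_le h.le
  obtain ⟨y, hy⟩ := hbij.2 (res w hw1.le)
  obtain ⟨a, ha, rfl⟩ := exists_res y
  obtain ⟨c, hc, hca⟩ := exists_teichmuller ha
  have haw : ‖algebraMap E D a - w‖ < 1 :=
    (res_eq_res (hx := by rwa [norm_algebraMap']) (hy := hw1.le)).1 hy
  refine ⟨c, teichmuller_unique (Algebra.commutes c w) ?_ hw ?_⟩
  · rw [h, ← map_pow, hc]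
  · rw [← sub_add_sub_cancel _ (algebraMap E D a), ← map_sub]
    refine (IsUltrametricDist.norm_add_le_max _ _).trans_lt (max_lt ?_ haw)
    rwa [norm_algebraMap']

/-- A central division algebra of prime degree `p` over a local field has ramification index and
residue degree `p`, and a root of unity generating its residue field is not central. -/
theorem central_structure [FiniteDimensional E D] [Algebra.IsCentral E D] {p : ℕ} (hp : p.Prime)
    (hD : finrank E D = p ^ 2) :
    ‖ϖ D‖ ^ p = ‖ϖ E‖ ∧ q D = q E ^ p ∧
      ∃ w x : D, w ≠ 0 ∧ w ^ q D = w ∧ x ≠ 0 ∧ ‖x‖ ≤ ‖w * x - x * w‖ := by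
  obtain ⟨w, hw0, hw, -, hgen⟩ := exists_generator D
  have hcent : ∀ z : D, (∀ y, z * y = y * z) → ∃ c : E, algebraMap E D c = z := fun z hz ↦ by
    have : z ∈ Subalgebra.center E D := Subalgebra.mem_center_iff.2 fun y ↦ (hz y).symm
    rwa [Algebra.IsCentral.center_eq_bot, Algebra.mem_bot] at this
  have hnc : ∃ x, w * x ≠ x * w := by
    by_contra! hc
    have h1 : Subalgebra.toSubmodule (Subalgebra.centralizer E {ϖ D}) = ⊤ := by
      refine eq_top_of_approx _ fun d hd ↦ ?_
      obtain ⟨n, k, hnk⟩ := exists_approx hgen rfl hd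
      refine ⟨_, ?_, hnk⟩
      rw [Subalgebra.mem_toSubmodule, Subalgebra.mem_centralizer_iff]
      rintro _ rfl
      exact (((show Commute w (ϖ D) from hc _).pow_left n).mul_left
        ((Commute.refl (ϖ D)).zpow_left₀ k)).symm
    obtain ⟨a, ha⟩ := hcent (ϖ D) fun y ↦ by
      have : y ∈ Subalgebra.toSubmodule (Subalgebra.centralizer E {ϖ D}) := h1 ▸ Submodule.mem_top
      rw [Subalgebra.mem_toSubmodule, Subalgebra.mem_centralizer_iff] at this
      exact this _ rfl
    obtain ⟨c, hwc⟩ := hcent w hc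
    have h2 : Subalgebra.toSubmodule (⊥ : Subalgebra E D) = ⊤ := by
      refine eq_top_of_approx _ fun d hd ↦ ?_
      obtain ⟨n, k, hnk⟩ := exists_approx hgen rfl hd
      refine ⟨_, ?_, hnk⟩
      rw [Subalgebra.mem_toSubmodule, Algebra.mem_bot]
      exact ⟨c ^ n * a ^ k, by simp [← ha, ← hwc]⟩
    have h3 : finrank E (Subalgebra.toSubmodule (⊥ : Subalgebra E D)) = p ^ 2 := by
      rw [h2, finrank_top, hD]
    rw [Subalgebra.finrank_toSubmodule, Subalgebra.finrank_bot] at h3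
    exact (Nat.one_lt_pow two_ne_zero hp.one_lt).ne h3
  obtain ⟨e, f, he, hf, hef⟩ := exists_ramification_inertia E D
  rw [hD] at hef
  have hep : e = p ∧ f = p := by
    obtain ⟨i, hi, rfl⟩ := (Nat.dvd_prime_pow hp).1 (Dvd.intro f hef.symm)
    interval_cases i
    · exfalso
      rw [pow_zero, pow_one] at he
      have h1 : Subalgebra.toSubmodule (Subalgebra.centralizer E {w}) = ⊤ := by
        refine eq_top_of_approx _ fun d hd ↦ ?_
        obtain ⟨n, k, hnk⟩ := exists_approx (x := algebraMap E D (ϖ E)) hgen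
          (by rw [norm_algebraMap', he]) hd
        refine ⟨_, ?_, hnk⟩
        rw [Subalgebra.mem_toSubmodule, Subalgebra.mem_centralizer_iff]
        intro g hg
        rw [Set.mem_singleton_iff.1 hg]
        exact ((Commute.refl w).pow_right n).mul_right
          ((show Commute w (algebraMap E D (ϖ E)) from (Algebra.commutes _ w).symm).zpow_right₀ k)
      obtain ⟨x, hx⟩ := hnc
      have : x ∈ Subalgebra.toSubmodule (Subalgebra.centralizer E {w}) := h1 ▸ Submodule.mem_top
      rw [Subalgebra.mem_toSubmodule, Subalgebra.mem_centralizer_iff] at this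
      exact hx (this _ rfl)
    · rw [pow_one] at hef ⊢
      refine ⟨rfl, Nat.eq_of_mul_eq_mul_left hp.pos ?_⟩
      rw [← hef, sq]
    · exfalso
      have : f = 1 := by
        refine Nat.eq_of_mul_eq_mul_left (pow_pos hp.pos 2) ?_
        rw [← hef, mul_one]
      rw [this, pow_one] at hf
      obtain ⟨c, rfl⟩ := exists_teichmuller_of_q_eq hf hw
      obtain ⟨x, hx⟩ := hnc
      exact hx (Algebra.commutes c x)
  obtain ⟨x, hx0, hx⟩ := exists_norm_commutator hw0 hw hnc
  exact ⟨hep.1 ▸ he, hep.2 ▸ hf, w, x, hw0, hw, hx0, hx⟩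

end Central


theorem commute_of_pow_eq_one {F B : Type*} [Field F] [DivisionRing B] [Algebra F B] {N : ℕ}
    (hN : 0 < N) {ζ : F} (hζ : IsPrimitiveRoot ζ N) {b : B} (hb : b ^ N = 1) (y : B) :
    b * y = y * b := by
  have hxi : IsIntegral F b :=
    ⟨Polynomial.X ^ N - 1, Polynomial.monic_X_pow_sub_C 1 hN.ne', by simp [hb]⟩
  have hdvd : minpoly F b ∣ Polynomial.X ^ N - 1 := minpoly.dvd _ _ (by simp [hb])
  rw [Polynomial.X_pow_sub_one_eq_prod hN hζ] at hdvd
  obtain ⟨a, -, ha⟩ := (Prime.dvd_finsetProd_iff (minpoly.prime hxi) _).1 hdvd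
  have h0 : Polynomial.aeval b (Polynomial.X - Polynomial.C a) = 0 := by
    obtain ⟨c, hc⟩ := ha
    rw [hc, map_mul, minpoly.aeval, zero_mul]
  have hba : b = algebraMap F B a := by
    simpa [sub_eq_zero] using h0
  rw [hba, Algebra.commutes]

/-- A division algebra of prime degree `p` over a local field `E` does not embed isometrically into
a division algebra with center containing an extension `F` of `E` of degree divisible by `p`. -/
theorem not_isometric_of_dvd {E F D B : Type*} [NormedField E] [IsLocalDivisionRing E]
    [NormedField F] [IsLocalDivisionRing F] [NormedDivisionRing D] [IsLocalDivisionRing D]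
    [NormedDivisionRing B] [IsLocalDivisionRing B] [NormedAlgebra E F] [NormedAlgebra E D]
    [NormedAlgebra F B] [FiniteDimensional E F] [FiniteDimensional E D] [Algebra.IsCentral E D]
    {p : ℕ} (hp : p.Prime) (hD : finrank E D = p ^ 2) (hF : p ∣ finrank E F)
    (g : D →+* B) (hg : ∀ x, ‖g x‖ = ‖x‖) : False := by
  obtain ⟨hϖ, hq, w, x, hw0, hw, hx0, hwx⟩ := central_structure (E := E) (D := D) hp hD
  obtain ⟨e, f, he, hf, hef⟩ := exists_ramification_inertia E F
  have hq1 := one_lt_q (A := D)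
  have hw1 : w ^ (q D - 1) = 1 := by
    have : w ^ (q D - 1) * w = 1 * w := by
      rw [← pow_succ, Nat.sub_add_cancel hq1.le, hw, one_mul]
    exact mul_right_cancel₀ hw0 this
  have hnw : ‖w‖ = 1 := by
    have h := congrArg norm hw1
    rw [norm_pow, norm_one] at h
    exact (pow_eq_one_iff_of_nonneg (norm_nonneg _) (by omega)).1 h
  have hnx : 0 < ‖x‖ := norm_pos_iff.2 hx0
  rw [hef, hp.dvd_mul] at hF
  rcases hF with ⟨t, rfl⟩ | ⟨t, rfl⟩
  · have h1 : ‖ϖ F‖ ^ t = ‖ϖ D‖ := by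
      have : (‖ϖ F‖ ^ t) ^ p = ‖ϖ D‖ ^ p := by rw [hϖ, ← he, ← pow_mul, mul_comm]
      exact (pow_left_inj₀ (by positivity) (by positivity) hp.ne_zero).1 this
    obtain ⟨k, hk⟩ := exists_norm_eq_zpow hx0
    set P : F := (ϖ F ^ t) ^ k with hP
    have hP0 : P ≠ 0 := zpow_ne_zero _ (pow_ne_zero _ (ϖ_ne_zero (A := F)))
    have hPn : ‖P‖ = ‖x‖ := by rw [hP, norm_zpow, norm_pow, h1, hk]
    have hc := Algebra.commutes (A := B) P⁻¹
    set y : B := algebraMap F B P⁻¹ * g x with hy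
    have hyn : ‖y‖ = 1 := by
      rw [hy, norm_mul, norm_algebraMap', hg, norm_inv, hPn, inv_mul_cancel₀ hnx.ne']
    have h2 := norm_mul_sub_mul_lt_one (x := g w) (y := y) (by rw [hg, hnw]) hyn.le
    have h3 : g w * y - y * g w = algebraMap F B P⁻¹ * g (w * x - x * w) := by
      rw [hy, ← mul_assoc, ← hc, map_sub, map_mul, map_mul, mul_sub, mul_assoc, mul_assoc]
    rw [h3, norm_mul, norm_algebraMap', hg, norm_inv, hPn, inv_mul_lt_iff₀ hnx, mul_one] at h2
    exact absurd hwx (not_le.2 h2)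
  · obtain ⟨u, -, -, hu, -⟩ := exists_generator F
    have hqF : q F = q D ^ t := by rw [hf, hq, pow_mul]
    have hdvd : q D - 1 ∣ orderOf u := by
      rw [hu, hqF]
      simpa using Nat.sub_one_dvd_pow_sub_one (q D) t
    have hqF1 := one_lt_q (A := F)
    have ho : orderOf (u ^ (orderOf u / (q D - 1))) = q D - 1 :=
      orderOf_pow_orderOf_div (by omega) hdvd
    have hprim := IsPrimitiveRoot.orderOf (u ^ (orderOf u / (q D - 1)))
    rw [ho] at hprim
    have hcomm := commute_of_pow_eq_one (by omega) hprim (b := g w)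
      (by rw [← map_pow, hw1, map_one])
      (g x)
    have h0 : w * x - x * w = 0 := by
      rw [sub_eq_zero]
      exact g.injective (by rw [map_mul, map_mul, hcomm])
    rw [h0, norm_zero] at hwx
    exact absurd hwx (not_le.2 hnx)


section SpectralValue

variable (K : Type u) [NontriviallyNormedField K] {A : Type*} [DivisionRing A] [Algebra K A]

/-- The canonical norm on a finite-dimensional division algebra over a complete field. -/
noncomputable def canonicalNorm (x : A) : ℝ := spectralValue (minpoly K x)

theorem exists_simple_extension [FiniteDimensional K A] (x : A) :
    ∃ (L : Type u) (_ : Field L) (_ : Algebra K L)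
    (_ : FiniteDimensional K L) (φ : L →ₐ[K] A) (y : L), φ y = x ∧
      Algebra.norm K y = (-1) ^ finrank K L * (minpoly K x).coeff 0 ∧
      (minpoly K x).natDegree = finrank K L := by
  have hxi : IsIntegral K x := Algebra.IsIntegral.isIntegral x
  have : Fact (Irreducible (minpoly K x)) := ⟨minpoly.irreducible hxi⟩
  have hne := minpoly.ne_zero hxi
  let φ : AdjoinRoot (minpoly K x) →ₐ[K] A :=
    Ideal.Quotient.liftₐ (Ideal.span {minpoly K x}) (Polynomial.aeval x) (fun a ha => by
      obtain ⟨b, rfl⟩ := Ideal.mem_span_singleton.1 ha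
      rw [map_mul, minpoly.aeval, zero_mul])
  have hφ : φ (AdjoinRoot.root _) = x := by
    change Polynomial.aeval x (Polynomial.X : Polynomial K) = x
    simp
  let pb := AdjoinRoot.powerBasis hne
  refine ⟨AdjoinRoot (minpoly K x), inferInstance, inferInstance, pb.finite, φ,
    AdjoinRoot.root _, hφ, ?_, ?_⟩
  · have h := Algebra.PowerBasis.norm_gen_eq_coeff_zero_minpoly pb
    rw [← pb.finrank] at h
    change Algebra.norm K (AdjoinRoot.root (minpoly K x)) = _ at h
    rw [h]
    congr 2
    change (minpoly K (AdjoinRoot.root (minpoly K x))) = _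
    rw [← minpoly.algHom_eq φ φ.toRingHom.injective, hφ]
  · rw [pb.finrank]
    rfl

variable {K}

theorem canonicalNorm_algHom {B : Type*} [DivisionRing B] [Algebra K B] (φ : A →ₐ[K] B) (x : A) :
    canonicalNorm K (φ x) = canonicalNorm K x := by
  rw [canonicalNorm, minpoly.algHom_eq φ φ.toRingHom.injective, canonicalNorm]

theorem canonicalNorm_algebraMap (c : K) : canonicalNorm K (algebraMap K A c) = ‖c‖ := by
  rw [canonicalNorm, minpoly.eq_X_sub_C, spectralValue_X_sub_C]

theorem canonicalNorm_nonneg (x : A) : 0 ≤ canonicalNorm K x := spectralValue_nonneg _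

theorem canonicalNorm_zero : canonicalNorm K (0 : A) = 0 := by
  simpa using canonicalNorm_algebraMap (A := A) (0 : K)

theorem canonicalNorm_one : canonicalNorm K (1 : A) = 1 := by
  simpa using canonicalNorm_algebraMap (A := A) (1 : K)

variable [IsUltrametricDist K] [FiniteDimensional K A]

theorem canonicalNorm_add_one (x : A) : canonicalNorm K (x + 1) ≤ max (canonicalNorm K x) 1 := by
  obtain ⟨L, _, _, _, φ, y, rfl, -⟩ := exists_simple_extension K x
  rw [← map_one φ, ← map_add, canonicalNorm_algHom, canonicalNorm_algHom]
  have h := isNonarchimedean_spectralNorm (K := K) (L := L) y 1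
  rwa [spectralNorm_one] at h

variable [CompleteSpace K]

theorem canonicalNorm_pow_finrank (x : A) :
    canonicalNorm K x ^ finrank K A = ‖Algebra.norm K x‖ := by
  obtain ⟨L, _, _, _, φ, y, rfl, hy, hdeg⟩ := exists_simple_extension K x
  let _ : Module L A := Module.compHom A φ.toRingHom
  have hsmul (a : L) (b : A) : a • b = φ a * b := rfl
  have : IsScalarTower K L A := ⟨fun a b c => by
    rw [hsmul, hsmul, map_smul, smul_mul_assoc]⟩
  have : Module.Finite L A := Module.Finite.of_restrictScalars_finite K L A
  have h1 : Algebra.norm K (φ y) = Algebra.norm K y ^ finrank L A := by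
    rw [Algebra.norm_apply K (φ y), ← map_pow]
    have : (Algebra.lmul K A) (φ y) = ((y • LinearMap.id : A →ₗ[L] A) : A →ₗ[K] A) := by
      ext b
      rfl
    rw [this, LinearMap.det_restrictScalars, LinearMap.det_smul, LinearMap.det_id, mul_one]
  have hpos : (minpoly K y).natDegree ≠ 0 :=
    (minpoly.natDegree_pos (Algebra.IsIntegral.isIntegral y)).ne'
  have h2 : canonicalNorm K y ^ finrank K L = ‖Algebra.norm K y‖ := by
    have h3 := spectralNorm.spectralNorm_eq_norm_coeff_zero_rpow K L y
    have h4 : minpoly K (φ y) = minpoly K y := minpoly.algHom_eq φ φ.toRingHom.injective y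
    rw [h4] at hy hdeg
    change spectralNorm K L y ^ _ = _
    rw [h3, hy, norm_mul, norm_pow, norm_neg, norm_one, one_pow, one_mul, ← hdeg, one_div,
      Real.rpow_inv_natCast_pow (norm_nonneg _) hpos]
  rw [canonicalNorm_algHom, h1, norm_pow, ← h2, ← pow_mul, finrank_mul_finrank]

theorem canonicalNorm_mul (x y : A) :
    canonicalNorm K (x * y) = canonicalNorm K x * canonicalNorm K y := by
  have hpos : finrank K A ≠ 0 := finrank_pos.ne'
  refine (pow_left_inj₀ (canonicalNorm_nonneg _)
    (mul_nonneg (canonicalNorm_nonneg _) (canonicalNorm_nonneg _)) hpos).1 ?_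
  rw [mul_pow, canonicalNorm_pow_finrank, canonicalNorm_pow_finrank, canonicalNorm_pow_finrank,
    map_mul, norm_mul]

theorem canonicalNorm_neg (x : A) : canonicalNorm K (-x) = canonicalNorm K x := by
  have h : canonicalNorm K (-1 : A) = 1 := by
    simpa using canonicalNorm_algebraMap (A := A) (-1 : K)
  rw [← neg_one_mul, canonicalNorm_mul, h, one_mul]

theorem canonicalNorm_eq_zero {x : A} : canonicalNorm K x = 0 ↔ x = 0 := by
  refine ⟨fun h => by_contra fun hx => ?_, fun h => h ▸ canonicalNorm_zero⟩
  have := canonicalNorm_one (K := K) (A := A)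
  rw [← mul_inv_cancel₀ hx, canonicalNorm_mul, h, zero_mul] at this
  exact zero_ne_one this

theorem canonicalNorm_add (x y : A) :
    canonicalNorm K (x + y) ≤ max (canonicalNorm K x) (canonicalNorm K y) := by
  rcases eq_or_ne y 0 with rfl | hy
  · simp
  · have h := canonicalNorm_add_one (K := K) (x * y⁻¹)
    have h1 : x + y = (x * y⁻¹ + 1) * y := by rw [add_mul, inv_mul_cancel_right₀ hy, one_mul]
    have h2 : x = x * y⁻¹ * y := by rw [inv_mul_cancel_right₀ hy]
    conv_rhs => rw [h2]
    rw [h1, canonicalNorm_mul, canonicalNorm_mul]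
    refine (mul_le_mul_of_nonneg_right h (canonicalNorm_nonneg y)).trans_eq ?_
    rw [max_mul_of_nonneg _ _ (canonicalNorm_nonneg y), one_mul]

variable (K A)

/-- The metric attached to the canonical norm. -/
noncomputable abbrev canonicalMetric : MetricSpace A where
  dist x y := canonicalNorm K (-x + y)
  dist_self x := by simp [canonicalNorm_zero]
  dist_comm x y := by
    rw [← canonicalNorm_neg]
    congr 1
    abel
  dist_triangle x y z := by
    have h : -x + z = (-x + y) + (-y + z) := by abel
    rw [h]
    exact (canonicalNorm_add _ _).trans
      (max_le_add_of_nonneg (canonicalNorm_nonneg _) (canonicalNorm_nonneg _))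
  eq_of_dist_eq_zero {x y} h := by
    have := canonicalNorm_eq_zero.1 h
    rwa [neg_add_eq_zero] at this

/-- A finite-dimensional division algebra with its canonical norm. -/
noncomputable abbrev canonicalNormedDivisionRing : NormedDivisionRing A where
  norm := canonicalNorm K
  toDivisionRing := inferInstance
  toMetricSpace := canonicalMetric K A
  dist_eq _ _ := rfl
  norm_mul := canonicalNorm_mul

/-- A finite field extension with its canonical norm. -/
noncomputable abbrev canonicalNormedField (L : Type*) [Field L] [Algebra K L]
    [FiniteDimensional K L] : NormedField L where
  norm := canonicalNorm K
  toField := inferInstance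
  toMetricSpace := canonicalMetric K L
  dist_eq _ _ := rfl
  norm_mul := canonicalNorm_mul

end SpectralValue

theorem isLocalDivisionRing_of_norm_eq {K : Type*} [NontriviallyNormedField K]
    [IsUltrametricDist K] [ProperSpace K] {A : Type*} [NormedDivisionRing A]
    [Algebra K A] [FiniteDimensional K A] (h : ∀ x : A, ‖x‖ = canonicalNorm K x) :
    IsLocalDivisionRing A := by
  let _ : NormedAlgebra K A :=
    { norm_smul_le := fun c x => by
        rw [Algebra.smul_def, norm_mul, h (algebraMap K A c), canonicalNorm_algebraMap] }
  have h1 : IsUltrametricDist A :=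
    IsUltrametricDist.isUltrametricDist_of_isNonarchimedean_norm fun x y => by
      simp only [h]
      exact canonicalNorm_add x y
  have h2 : ProperSpace A := FiniteDimensional.proper K A
  obtain ⟨c, hc0, hc⟩ := NormedField.exists_norm_lt_one K
  exact { exists_norm_lt_one := ⟨algebraMap K A c, by simpa using hc0, by
    rwa [norm_algebraMap']⟩ }


theorem isSimpleRing_tensorProduct (E F D : Type*) [Field E] [Field F] [DivisionRing D]
    [Algebra E F] [Algebra E D] [Algebra.IsCentral E D] : IsSimpleRing (F ⊗[E] D) := by
  classical
  let b := Module.Basis.ofVectorSpace E F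
  let φ := TensorProduct.equivFinsuppOfBasisLeft (N := D) b
  have hl (d : D) (x : F ⊗[E] D) (i) : φ ((1 ⊗ₜ d) * x) i = d * φ x i := by
    induction x with
    | zero => simp
    | add x y hx hy => rw [mul_add, map_add, map_add, Finsupp.add_apply, Finsupp.add_apply, hx, hy,
        mul_add]
    | tmul f y => simp [φ]
  have hr (d : D) (x : F ⊗[E] D) (i) : φ (x * (1 ⊗ₜ d)) i = φ x i * d := by
    induction x with
    | zero => simp
    | add x y hx hy => rw [add_mul, map_add, map_add, Finsupp.add_apply, Finsupp.add_apply, hx, hy,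
        add_mul]
    | tmul f y => simp [φ]
  refine ⟨⟨fun I => or_iff_not_imp_left.2 fun hI => ?_⟩⟩
  have hex : ∃ n, ∃ x ∈ I, x ≠ 0 ∧ (φ x).support.card = n := by
    by_contra! h
    refine hI (eq_bot_iff.2 fun x hx => ?_)
    by_contra hx0
    exact h _ x hx hx0 rfl
  obtain ⟨x, hxI, hx0, hxn⟩ := Nat.find_spec hex
  have hmin (y) (hy : y ∈ I) (h : (φ y).support.card < (φ x).support.card) : y = 0 := by
    by_contra hy0
    rw [hxn] at h
    exact Nat.find_min hex h ⟨y, hy, hy0, rfl⟩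
  have hφx : φ x ≠ 0 := by simpa using hx0
  obtain ⟨i, hi⟩ := Finsupp.ne_iff.1 hφx
  rw [Finsupp.zero_apply] at hi
  set z := x * (1 ⊗ₜ (φ x i)⁻¹) with hz
  have hzI : z ∈ I := I.mul_mem_right _ _ hxI
  have hzi : φ z i = 1 := by rw [hz, hr, mul_inv_cancel₀ hi]
  have hzs : (φ z).support ⊆ (φ x).support := fun j hj => by
    rw [Finsupp.mem_support_iff, hz, hr] at hj
    exact Finsupp.mem_support_iff.2 (left_ne_zero_of_mul hj)
  have hcomm (d : D) : (1 ⊗ₜ d) * z - z * (1 ⊗ₜ d) = 0 := by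
    refine hmin _ (I.sub_mem (I.mul_mem_left _ _ hzI) (I.mul_mem_right _ _ hzI))
      (Finset.card_lt_card ?_)
    refine Finset.ssubset_of_subset_of_ssubset (fun j hj => ?_)
      (Finset.erase_ssubset (Finsupp.mem_support_iff.2 hi))
    rw [Finsupp.mem_support_iff, map_sub, Finsupp.sub_apply, hl d z, hr d z] at hj
    refine Finset.mem_erase.2 ⟨fun h => hj (by rw [h, hzi, mul_one, one_mul, sub_self]),
      hzs (Finsupp.mem_support_iff.2 fun h => hj (by rw [h, mul_zero, zero_mul, sub_self]))⟩
  have hcent (j) : ∃ e : E, algebraMap E D e = φ z j := by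
    have : φ z j ∈ Subalgebra.center E D := by
      rw [Subalgebra.mem_center_iff]
      intro d
      have h := congrArg (fun y => φ y j) (hcomm d)
      simp only [map_sub, Finsupp.sub_apply, hl, hr, map_zero, Finsupp.zero_apply] at h
      exact sub_eq_zero.1 h
    rw [Algebra.IsCentral.center_eq_bot] at this
    exact Algebra.mem_bot.1 this
  choose c hc using hcent
  have hzf : ∃ f : F, z = f ⊗ₜ 1 := by
    refine ⟨∑ j ∈ (φ z).support, c j • b j, ?_⟩
    rw [TensorProduct.sum_tmul]
    conv_lhs => rw [← φ.symm_apply_apply z, TensorProduct.equivFinsuppOfBasisLeft_symm_apply]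
    refine Finset.sum_congr rfl fun j _ => ?_
    rw [TensorProduct.smul_tmul, ← Algebra.algebraMap_eq_smul_one, hc]
  obtain ⟨f, hf⟩ := hzf
  have hf0 : f ≠ 0 := by
    rintro rfl
    rw [TensorProduct.zero_tmul] at hf
    rw [hf] at hzi
    simp at hzi
  rw [eq_top_iff]
  intro y _
  have : y = y * (f⁻¹ ⊗ₜ 1) * z := by
    rw [hf, mul_assoc, Algebra.TensorProduct.tmul_mul_tmul, inv_mul_cancel₀ hf0, mul_one,
      ← Algebra.TensorProduct.one_def, mul_one]
  rw [this]
  exact I.mul_mem_left _ _ hzI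

theorem exists_algEquiv_matrix_or_divisionRing {F : Type*} {B : Type v} [Field F] [Ring B]
    [Algebra F B] [FiniteDimensional F B] [IsSimpleRing B] {p : ℕ} (hp : p.Prime)
    (hB : finrank F B = p ^ 2) :
    Nonempty (B ≃ₐ[F] Matrix (Fin p) (Fin p) F) ∨
      ∃ (D : Type v) (_ : DivisionRing D) (_ : Algebra F D) (_ : FiniteDimensional F D),
        Nonempty (B →ₐ[F] D) := by
  have := IsArtinianRing.of_finite F B
  obtain ⟨n, hn, D, _, _, hfin, ⟨e⟩⟩ := IsSimpleRing.exists_algEquiv_matrix_divisionRing_finite F B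
  have hdim : n ^ 2 * finrank F D = p ^ 2 := by
    rw [← hB, e.toLinearEquiv.finrank_eq, Module.finrank_matrix]
    simp [pow_two]
  have hnp : n ∣ p := (Nat.pow_dvd_pow_iff two_ne_zero).1 ⟨_, hdim.symm⟩
  rcases (Nat.dvd_prime hp).1 hnp with rfl | rfl
  · refine .inr ⟨D, inferInstance, inferInstance, hfin, ⟨?_⟩⟩
    let ε : Matrix (Fin 1) (Fin 1) D →ₐ[F] D :=
      { toFun := fun M => M 0 0
        map_one' := by simp
        map_mul' := fun M N => by simp [Matrix.mul_apply]
        map_zero' := rfl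
        map_add' := fun _ _ => rfl
        commutes' := fun c => by simp [Matrix.algebraMap_matrix_apply] }
    exact ε.comp e.toAlgHom
  · have h1 : finrank F D = 1 := by
      have : 0 < n ^ 2 := pow_pos hp.pos 2
      exact Nat.eq_of_mul_eq_mul_left this (by rw [hdim, mul_one])
    have hbot := Subalgebra.bot_eq_top_of_finrank_eq_one h1
    have hbij : Function.Bijective (Algebra.ofId F D) :=
      ⟨(Algebra.ofId F D).toRingHom.injective, fun x => by
        have : x ∈ (⊥ : Subalgebra F D) := hbot ▸ Algebra.mem_top
        exact Algebra.mem_bot.1 this⟩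
    exact .inl ⟨e.trans (AlgEquiv.ofBijective _ hbij).symm.mapMatrix⟩

/-- A division algebra of prime degree `p` over a local field `E` is split by every finite
extension of `E` of degree divisible by `p`. -/
theorem split_of_dvd_finrank (K : Type*) [NontriviallyNormedField K] [IsUltrametricDist K]
    [ProperSpace K] (E F D : Type*) [Field E] [Algebra K E] [FiniteDimensional K E] [Field F]
    [Algebra E F] [FiniteDimensional E F] [DivisionRing D] [Algebra E D] [Algebra.IsCentral E D]
    {p : ℕ} (hp : p.Prime) (hD : finrank E D = p ^ 2) (hF : p ∣ finrank E F) :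
    Nonempty ((F ⊗[E] D) ≃ₐ[F] Matrix (Fin p) (Fin p) F) := by
  have hED : FiniteDimensional E D := .of_finrank_pos (by rw [hD]; exact pow_pos hp.pos 2)
  have := isSimpleRing_tensorProduct E F D
  rcases exists_algEquiv_matrix_or_divisionRing (F := F) (B := F ⊗[E] D) hp
    (by rw [Module.finrank_baseChange, hD]) with h | ⟨B, _, _, _, ⟨ψ⟩⟩
  · exact h
  exfalso
  let _ : Algebra K F := ((algebraMap E F).comp (algebraMap K E)).toAlgebra
  let _ : Algebra K D := Algebra.compHom D (algebraMap K E)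
  let _ : Algebra K B := Algebra.compHom B (algebraMap K F)
  have : IsScalarTower K E F := .of_algebraMap_eq fun _ => rfl
  have : IsScalarTower K E D := .of_algebraMap_eq fun _ => rfl
  have : IsScalarTower K F B := .of_algebraMap_eq fun _ => rfl
  have : FiniteDimensional K F := .trans K E F
  have : FiniteDimensional K D := .trans K E D
  have : FiniteDimensional K B := .trans K F B
  let g : D →ₐ[K] B :=
    { (ψ.toRingHom.comp (Algebra.TensorProduct.includeRight (R := E) (A := F) (B := D)).toRingHom)
      with
      commutes' := fun c => by
        change ψ (1 ⊗ₜ algebraMap E D (algebraMap K E c)) =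
          algebraMap F B (algebraMap E F (algebraMap K E c))
        rw [← ψ.commutes, Algebra.TensorProduct.algebraMap_apply,
          ← Algebra.TensorProduct.tmul_one_eq_one_tmul]
        rfl }
  let _ : NormedField E := canonicalNormedField K E
  let _ : NormedField F := canonicalNormedField K F
  let _ : NormedDivisionRing D := canonicalNormedDivisionRing K D
  let _ : NormedDivisionRing B := canonicalNormedDivisionRing K B
  have : IsLocalDivisionRing E := isLocalDivisionRing_of_norm_eq (K := K) fun _ => rfl
  have : IsLocalDivisionRing F := isLocalDivisionRing_of_norm_eq (K := K) fun _ => rfl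
  have : IsLocalDivisionRing D := isLocalDivisionRing_of_norm_eq (K := K) fun _ => rfl
  have : IsLocalDivisionRing B := isLocalDivisionRing_of_norm_eq (K := K) fun _ => rfl
  let _ : NormedAlgebra E F :=
    { norm_smul_le := fun c x => by
        rw [Algebra.smul_def, norm_mul]
        exact (congrArg (· * ‖x‖) (canonicalNorm_algHom (IsScalarTower.toAlgHom K E F) c)).le }
  let _ : NormedAlgebra E D :=
    { norm_smul_le := fun c x => by
        rw [Algebra.smul_def, norm_mul]
        exact (congrArg (· * ‖x‖) (canonicalNorm_algHom (IsScalarTower.toAlgHom K E D) c)).le }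
  let _ : NormedAlgebra F B :=
    { norm_smul_le := fun c x => by
        rw [Algebra.smul_def, norm_mul]
        exact (congrArg (· * ‖x‖) (canonicalNorm_algHom (IsScalarTower.toAlgHom K F B) c)).le }
  exact not_isometric_of_dvd (E := E) (F := F) hp hD hF g.toRingHom fun x =>
    canonicalNorm_algHom g x


section Uniformizer

variable {L : Type*} [NormedField L] [IsLocalDivisionRing L]

theorem norm_one_add_pow_sub_le {p : ℕ} (hp : p.Prime) {y : L} (hy : ‖y‖ ≤ 1) :
    ‖(1 + y) ^ p - 1 - y ^ p‖ ≤ ‖(p : L)‖ := by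
  obtain ⟨r, hr⟩ := exists_add_pow_prime_eq hp (1 : integers L) ⟨y, hy⟩
  have h := congrArg (fun x : integers L => (x : L)) hr
  have h1 : (1 + y) ^ p - 1 - y ^ p = p * (y * (r : L)) := by
    have h2 : (1 + y) ^ p = 1 ^ p + y ^ p + p * 1 * y * (r : L) := h
    rw [h2]
    ring
  rw [h1, norm_mul, norm_mul]
  have hr1 : ‖(r : L)‖ ≤ 1 := r.2
  exact mul_le_of_le_one_right (norm_nonneg _) (mul_le_one₀ hy (norm_nonneg _) hr1)

theorem norm_one_add_pow_ϖ {i : ℕ} (hi : i ≠ 0) : ‖1 + ϖ L ^ i‖ = 1 := by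
  have h : ‖ϖ L ^ i‖ < 1 := by
    rw [norm_pow]
    exact pow_lt_one₀ (norm_nonneg _) norm_ϖ_lt_one hi
  rw [IsUltrametricDist.norm_add_eq_max_of_norm_ne_norm (by rw [norm_one]; exact h.ne'), norm_one,
    max_eq_left h.le]

theorem one_add_pow_ϖ_ne {p : ℕ} (hp : p.Prime) {i j : ℕ} (hi : i ≠ 0) (hij : i < j)
    (hpi : ¬ p ∣ i) (hnorm : ‖(p : L)‖ < ‖ϖ L‖ ^ i) (z : L) :
    1 + ϖ L ^ i ≠ (1 + ϖ L ^ j) * z ^ p := by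
  intro h
  have hj : j ≠ 0 := by omega
  have hlt : ‖ϖ L ^ j‖ < ‖ϖ L ^ i‖ := by
    rw [norm_pow, norm_pow]
    exact pow_lt_pow_right_of_lt_one₀ norm_ϖ_pos norm_ϖ_lt_one hij
  have hz : ‖z‖ = 1 := by
    have h1 := congrArg norm h
    rw [norm_mul, norm_one_add_pow_ϖ hi, norm_one_add_pow_ϖ hj, one_mul, norm_pow] at h1
    exact (pow_eq_one_iff_of_nonneg (norm_nonneg _) hp.ne_zero).1 h1.symm
  have hz1 : ‖z ^ p - 1‖ = ‖ϖ L‖ ^ i := by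
    have h1 : (1 + ϖ L ^ j) * (z ^ p - 1) = ϖ L ^ i - ϖ L ^ j := by
      rw [mul_sub, ← h]
      ring
    have h2 := congrArg norm h1
    rw [norm_mul, norm_one_add_pow_ϖ hj, one_mul] at h2
    rw [h2, sub_eq_add_neg, IsUltrametricDist.norm_add_eq_max_of_norm_ne_norm
      (by rw [norm_neg]; exact hlt.ne'), norm_neg, max_eq_left hlt.le, norm_pow]
  set y := z - 1 with hy
  have hy1 : ‖y‖ ≤ 1 := by
    rw [hy, sub_eq_add_neg]
    refine (IsUltrametricDist.norm_add_le_max _ _).trans ?_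
    rw [norm_neg, norm_one, hz, max_self]
  have hzy : z = 1 + y := by rw [hy]; ring
  have h3 := (norm_one_add_pow_sub_le hp hy1).trans_lt hnorm
  rw [← hzy, ← hz1] at h3
  have h4 : ‖y‖ ^ p = ‖ϖ L‖ ^ i := by
    have h5 : y ^ p = (z ^ p - 1) + -(z ^ p - 1 - y ^ p) := by ring
    rw [← norm_pow, h5, IsUltrametricDist.norm_add_eq_max_of_norm_ne_norm
      (by rw [norm_neg]; exact h3.ne'), norm_neg, max_eq_left h3.le, hz1]
  have hy0 : y ≠ 0 := by
    rintro h0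
    rw [h0, norm_zero, zero_pow hp.ne_zero] at h4
    exact (pow_pos (norm_ϖ_pos (A := L)) i).ne h4
  obtain ⟨l, hl⟩ := exists_norm_eq_zpow hy0
  rw [hl, ← zpow_natCast, ← zpow_natCast, ← zpow_mul] at h4
  have h6 := zpow_norm_ϖ_inj.1 h4
  exact hpi (Int.natCast_dvd_natCast.1 ⟨l, by rw [← h6, mul_comm]⟩)

end Uniformizer

theorem exists_ramified_parameter {p : ℕ} [Fact p.Prime] (K : Type*) [Field K] [Algebra ℚ_[p] K]
    [FiniteDimensional ℚ_[p] K] : ∃ c : K, ∀ (L : Type v) [Field L] [Algebra K L]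
      [FiniteDimensional K L] (m : ℕ) (z : L), z ^ m = algebraMap K L c →
      m ∣ finrank K L ∧ ∃ a : ℕ → L, (∀ i, a i ≠ 0) ∧
        ∀ i j, i < j → p * j + 1 < m → ∀ y, a i ≠ a j * y ^ p := by
  have hp : p.Prime := Fact.out
  let _ : NormedField K := canonicalNormedField ℚ_[p] K
  have : IsLocalDivisionRing K := isLocalDivisionRing_of_norm_eq (K := ℚ_[p]) fun _ => rfl
  refine ⟨ϖ K, fun L _ _ _ m z hz => ?_⟩
  let _ : Algebra ℚ_[p] L := ((algebraMap K L).comp (algebraMap ℚ_[p] K)).toAlgebra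
  have : IsScalarTower ℚ_[p] K L := .of_algebraMap_eq fun _ => rfl
  have : FiniteDimensional ℚ_[p] L := .trans ℚ_[p] K L
  let _ : NormedField L := canonicalNormedField ℚ_[p] L
  have : IsLocalDivisionRing L := isLocalDivisionRing_of_norm_eq (K := ℚ_[p]) fun _ => rfl
  have hKL (c : K) : ‖algebraMap K L c‖ = ‖c‖ :=
    canonicalNorm_algHom (IsScalarTower.toAlgHom ℚ_[p] K L) c
  let _ : NormedAlgebra K L :=
    { norm_smul_le := fun c x => by rw [Algebra.smul_def, norm_mul, hKL] }
  obtain ⟨e, f, he, -, hef⟩ := exists_ramification_inertia K L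
  have hz0 : z ≠ 0 ∨ m = 0 := by
    by_contra! h
    rw [h.1, zero_pow h.2] at hz
    exact ϖ_ne_zero (A := K) ((algebraMap K L).injective (by rw [← hz, map_zero]))
  have hzn : ‖z‖ ^ m = ‖ϖ L‖ ^ e := by rw [he, ← hKL, ← hz, norm_pow]
  have he0 : e ≠ 0 := by
    rintro rfl
    rw [zero_mul] at hef
    exact finrank_pos.ne' hef
  have hme : m ∣ e := by
    rcases eq_or_ne m 0 with rfl | hm
    · rw [pow_zero] at hzn
      have := pow_lt_one₀ (norm_nonneg _) (norm_ϖ_lt_one (A := L)) he0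
      exact absurd hzn this.ne'
    · obtain ⟨l, hl⟩ := exists_norm_eq_zpow (hz0.resolve_right hm)
      rw [hl, ← zpow_natCast, ← zpow_natCast, ← zpow_mul] at hzn
      exact Int.natCast_dvd_natCast.1 ⟨l, by rw [← zpow_norm_ϖ_inj.1 hzn, mul_comm]⟩
  refine ⟨hef ▸ hme.mul_right f, fun i => 1 + ϖ L ^ (p * i + 1), fun i h => ?_,
    fun i j hij hj y => ?_⟩
  · have := norm_one_add_pow_ϖ (L := L) (i := p * i + 1) (by omega)
    beta_reduce at h
    rw [h, norm_zero] at this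
    exact zero_ne_one this
  · have hlt : p * i < p * j := Nat.mul_lt_mul_of_pos_left hij hp.pos
    refine one_add_pow_ϖ_ne hp (by omega) (by omega) (fun h => ?_) ?_ y
    · exact hp.one_lt.ne' (Nat.dvd_one.1 ((Nat.dvd_add_right (dvd_mul_right p i)).1 h))
    · have h1 : ‖(p : K)‖ ≤ ‖ϖ K‖ := by
        refine norm_le_norm_ϖ ?_
        have := canonicalNorm_algebraMap (A := K) (p : ℚ_[p])
        rw [map_natCast] at this
        exact this.trans_lt Padic.norm_p_lt_one
      have h2 : ‖(p : L)‖ = ‖(p : K)‖ := by rw [← hKL, map_natCast]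
      rw [h2]
      refine h1.trans_lt ?_
      rw [← he]
      exact pow_lt_pow_right_of_lt_one₀ norm_ϖ_pos norm_ϖ_lt_one
        ((by omega : p * i + 1 < m).trans_le (Nat.le_of_dvd (by omega) hme))

section Kummer

theorem linearIndependent_of_pow_eq {K Ω : Type*} [Field K] [Field Ω] [Algebra K Ω]
    [IsGalois K Ω] {p : ℕ} (hp : p.Prime) {ζ : K} (hζ : IsPrimitiveRoot ζ p) {ι : Type*}
    [LinearOrder ι] {a : ι → K} (ha0 : ∀ i, a i ≠ 0) (ha : ∀ i j, i < j → ∀ y, a i ≠ a j * y ^ p)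
    {z : ι → Ω} (hz : ∀ i, z i ^ p = algebraMap K Ω (a i)) : LinearIndependent K z := by
  have : NeZero p := ⟨hp.ne_zero⟩
  have hz0 (i) : z i ≠ 0 := by
    intro h
    have := hz i
    rw [h, zero_pow hp.ne_zero] at this
    exact ha0 i ((algebraMap K Ω).injective (by rw [← this, map_zero]))
  have hroot (i) (σ : Gal(Ω/K)) : ∃ ω : K, algebraMap K Ω ω = σ (z i) / z i := by
    have h1 : (σ (z i) / z i) ^ p = 1 := by
      rw [div_pow, ← map_pow, hz, σ.commutes, div_self]
      exact (map_ne_zero _).2 (ha0 i)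
    obtain ⟨n, -, hn⟩ := (hζ.map_of_injective (algebraMap K Ω).injective).eq_pow_of_pow_eq_one h1
    exact ⟨ζ ^ n, by rw [map_pow, hn]⟩
  let χ (i : ι) : Gal(Ω/K) →* Ω :=
    { toFun := fun σ => σ (z i) / z i
      map_one' := div_self (hz0 i)
      map_mul' := fun σ τ => by
        obtain ⟨ω, hω⟩ := hroot i τ
        have h1 : τ (z i) = algebraMap K Ω ω * z i := by rw [hω, div_mul_cancel₀ _ (hz0 i)]
        rw [AlgEquiv.mul_apply, ← hω, h1, map_mul, σ.commutes, mul_div_assoc, mul_comm] }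
  have hχ_ne (i j) (hij : i < j) : χ i ≠ χ j := by
    intro h
    have hfix : z i / z j ∈ Set.range (algebraMap K Ω) := by
      rw [InfiniteGalois.mem_range_algebraMap_iff_fixed]
      intro σ
      have h1 : σ (z i) / z i = σ (z j) / z j := DFunLike.congr_fun h σ
      have h2 : σ (z j) ≠ 0 := (map_ne_zero _).2 (hz0 j)
      rw [map_div₀, div_eq_div_iff h2 (hz0 j)]
      rw [div_eq_div_iff (hz0 i) (hz0 j)] at h1
      rw [h1, mul_comm]
    obtain ⟨y, hy⟩ := hfix
    refine ha i j hij y ((algebraMap K Ω).injective ?_)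
    rw [map_mul, map_pow, hy, ← hz, ← hz, div_pow, mul_div_cancel₀ _ (pow_ne_zero _ (hz0 j))]
  have hχ : Function.Injective χ := by
    intro i j h
    rcases lt_trichotomy i j with hij | hij | hij
    · exact absurd h (hχ_ne i j hij)
    · exact hij
    · exact absurd h.symm (hχ_ne j i hij)
  have hli := (linearIndependent_monoidHom Gal(Ω/K) Ω).comp χ hχ
  rw [linearIndependent_iff'] at hli ⊢
  intro s g hg i hi
  have h1 := hli s (fun i => algebraMap K Ω (g i) * z i) (by
    ext σ
    have h2 := congrArg σ hg
    rw [map_sum, map_zero] at h2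
    rw [Finset.sum_apply, Pi.zero_apply, ← h2]
    refine Finset.sum_congr rfl fun j _ => ?_
    change algebraMap K Ω (g j) * z j * (σ (z j) / z j) = σ (g j • z j)
    rw [Algebra.smul_def, map_mul, σ.commutes, mul_assoc, mul_div_cancel₀ _ (hz0 j)]) i hi
  exact (algebraMap K Ω).injective (by rw [(mul_eq_zero.1 h1).resolve_right (hz0 i), map_zero])

theorem exists_not_pow {K L : Type*} [Field K] [CharZero K] [Field L] [Algebra K L]
    [FiniteDimensional K L] {p : ℕ} (hp : p.Prime) {ζ : K} (hζ : IsPrimitiveRoot ζ p) {n : ℕ}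
    (hn : finrank K L < n) {a : Fin n → K} (ha0 : ∀ i, a i ≠ 0)
    (ha : ∀ i j, i < j → ∀ y, a i ≠ a j * y ^ p) :
    ∃ i, ∀ z : L, z ^ p ≠ algebraMap K L (a i) := by
  by_contra! h
  choose z hz using h
  let φ : L →ₐ[K] AlgebraicClosure K := IsAlgClosed.lift
  have : IsGalois K (AlgebraicClosure K) := IsAlgClosure.isGalois K _
  have hli : LinearIndependent K (φ.toLinearMap ∘ z) :=
    linearIndependent_of_pow_eq hp hζ ha0 ha fun i => by
      change φ (z i) ^ p = _
      rw [← map_pow, hz, φ.commutes]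
  have := (LinearIndependent.of_comp _ hli).fintype_card_le_finrank
  rw [Fintype.card_fin] at this
  omega

theorem finrank_adjoin_of_pow_eq {K Ω : Type*} [Field K] [Field Ω] [Algebra K Ω] {p : ℕ}
    (hp : p.Prime) {a : K} (ha : ∀ b, b ^ p ≠ a) {z : Ω} (hz : z ^ p = algebraMap K Ω a) :
    finrank K (IntermediateField.adjoin K {z}) = p := by
  have hmonic := Polynomial.monic_X_pow_sub_C a hp.ne_zero
  have hirr := X_pow_sub_C_irreducible_of_prime hp ha
  have hxi : IsIntegral K z := ⟨_, hmonic, by simp [hz]⟩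
  rw [IntermediateField.adjoin.finrank hxi, ← minpoly.eq_of_irreducible_of_monic hirr
    (by simp [hz]) hmonic, Polynomial.natDegree_X_pow_sub_C]

theorem finrank_adjoin_le_of_pow_eq {K Ω : Type*} [Field K] [Field Ω] [Algebra K Ω] {n : ℕ}
    (hn : n ≠ 0) {a : K} {z : Ω} (hz : z ^ n = algebraMap K Ω a) :
    FiniteDimensional K (IntermediateField.adjoin K {z}) ∧
      finrank K (IntermediateField.adjoin K {z}) ≤ n := by
  have hmonic := Polynomial.monic_X_pow_sub_C a hn
  have hxi : IsIntegral K z := ⟨_, hmonic, by simp [hz]⟩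
  refine ⟨IntermediateField.adjoin.finiteDimensional hxi, ?_⟩
  rw [IntermediateField.adjoin.finrank hxi, ← Polynomial.natDegree_X_pow_sub_C (n := n) (r := a)]
  exact Polynomial.natDegree_le_of_dvd (minpoly.dvd _ _ (by simp [hz])) hmonic.ne_zero

theorem finrank_adjoin_primitiveRoot {K Ω : Type*} [Field K] [Field Ω] [Algebra K Ω] {p : ℕ}
    (hp : p.Prime) {ζ : Ω} (hζ : IsPrimitiveRoot ζ p) :
    FiniteDimensional K (IntermediateField.adjoin K {ζ}) ∧
      (finrank K (IntermediateField.adjoin K {ζ})).Coprime p := by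
  have hxi : IsIntegral K ζ :=
    ⟨_, Polynomial.monic_X_pow_sub_C 1 hp.ne_zero, by simp [hζ.pow_eq_one]⟩
  have hfin := IntermediateField.adjoin.finiteDimensional hxi
  refine ⟨hfin, Nat.Coprime.symm ((Nat.Prime.coprime_iff_not_dvd hp).2 fun h => ?_)⟩
  have h1 := Nat.le_of_dvd finrank_pos h
  rw [IntermediateField.adjoin.finrank hxi] at h1
  have hroot : Polynomial.aeval ζ (Polynomial.cyclotomic p K) = 0 := by
    have h := hζ.isRoot_cyclotomic hp.pos
    rwa [Polynomial.IsRoot, ← Polynomial.map_cyclotomic p (algebraMap K Ω),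
      Polynomial.eval_map_algebraMap] at h
  have h2 := Polynomial.natDegree_le_of_dvd (minpoly.dvd K ζ hroot)
    (Polynomial.cyclotomic.monic p K).ne_zero
  rw [Polynomial.natDegree_cyclotomic, Nat.totient_prime hp] at h2
  have := hp.pos
  omega

end Kummer


section Construction

open IntermediateField

variable {p : ℕ} [Fact p.Prime] (k : Type*) [Field k] [Algebra ℚ_[p] k] [FiniteDimensional ℚ_[p] k]

theorem exists_coprime_extension (n : ℕ) :
    ∃ K : IntermediateField k (AlgebraicClosure k), FiniteDimensional k K ∧
      (finrank k K).Coprime p ∧ (∃ ζ : K, IsPrimitiveRoot ζ p) ∧ ∃ a : ℕ → K, (∀ i, a i ≠ 0) ∧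
        ∀ i j, i < j → j < n → ∀ y, a i ≠ a j * y ^ p := by
  have hp : p.Prime := Fact.out
  have : CharZero k := charZero_of_injective_algebraMap (algebraMap ℚ_[p] k).injective
  have : CharZero (AlgebraicClosure k) :=
    charZero_of_injective_algebraMap (algebraMap k (AlgebraicClosure k)).injective
  have : NeZero (p : AlgebraicClosure k) := ⟨Nat.cast_ne_zero.2 hp.ne_zero⟩
  obtain ⟨ζ, hζ⟩ := HasEnoughRootsOfUnity.exists_primitiveRoot (AlgebraicClosure k) p
  obtain ⟨hfin, hcop⟩ := finrank_adjoin_primitiveRoot (K := k) hp hζ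
  set k₁ := k⟮ζ⟯ with hk₁
  have : FiniteDimensional ℚ_[p] k₁ := .trans ℚ_[p] k k₁
  obtain ⟨c, hc⟩ := exists_ramified_parameter (p := p) k₁
  set m := p * n + 1 with hm
  obtain ⟨z, hz⟩ := IsAlgClosed.exists_pow_nat_eq (algebraMap k₁ (AlgebraicClosure k) c)
    (n := m) (by omega)
  obtain ⟨hfin', hle⟩ := finrank_adjoin_le_of_pow_eq (by omega) hz
  obtain ⟨hdvd, a, ha0, ha⟩ := hc k₁⟮z⟯ m (AdjoinSimple.gen k₁ z)
    (Subtype.ext (by simpa using hz))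
  have hdeg : finrank k₁ k₁⟮z⟯ = m := hle.antisymm (Nat.le_of_dvd finrank_pos hdvd)
  refine ⟨restrictScalars k k₁⟮z⟯, ?_, ?_, ⟨⟨ζ, ?_⟩, ?_⟩, a, ha0, fun i j hij hj y => ?_⟩
  · exact FiniteDimensional.trans k k₁ k₁⟮z⟯
  · have h1 : finrank k k₁ * finrank k₁ k₁⟮z⟯ = finrank k k₁⟮z⟯ := finrank_mul_finrank k k₁ _
    change (finrank k k₁⟮z⟯).Coprime p
    rw [← h1, hdeg]
    refine hcop.mul_left ?_
    rw [hm, Nat.coprime_mul_left_add_left]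
    exact Nat.coprime_one_left p
  · exact k₁⟮z⟯.algebraMap_mem ⟨ζ, mem_adjoin_simple_self k ζ⟩
  · exact IsPrimitiveRoot.of_map_of_injective
      (f := (IntermediateField.restrictScalars k k₁⟮z⟯).val) hζ
      (IntermediateField.restrictScalars k k₁⟮z⟯).val.injective
  · exact ha i j hij (by rw [hm]; gcongr; exact hp.pos) y

theorem exists_ramified_extension (n : ℕ) :
    ∃ K : IntermediateField k (AlgebraicClosure k), FiniteDimensional k K ∧
      finrank k K = p ^ n := by
  have hp : p.Prime := Fact.out
  have hpn : p ^ n ≠ 0 := pow_ne_zero _ hp.ne_zero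
  obtain ⟨c, hc⟩ := exists_ramified_parameter (p := p) k
  obtain ⟨z, hz⟩ := IsAlgClosed.exists_pow_nat_eq (algebraMap k (AlgebraicClosure k) c)
    (Nat.pos_of_ne_zero hpn)
  obtain ⟨hfin, hle⟩ := finrank_adjoin_le_of_pow_eq hpn hz
  obtain ⟨hdvd, -⟩ := hc k⟮z⟯ (p ^ n) (AdjoinSimple.gen k z) (Subtype.ext (by simpa using hz))
  exact ⟨k⟮z⟯, hfin, hle.antisymm (Nat.le_of_dvd finrank_pos hdvd)⟩

end Construction

section Composite

open IntermediateField

variable {k : Type*} [Field k] {E : Type*} [Field E] [Algebra k E]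

/-- If `α ^ p` lies in a subfield `K` of `M` but is not a `p`-th power in the compositum of `K`
with all conjugates of `E`, then `p` divides the degree over `E` of every compositum of `M`
and `E`. -/
theorem dvd_finrank_of_pow_mem {p : ℕ} (hp : p.Prime)
    {K M : IntermediateField k (AlgebraicClosure k)} (hKM : K ≤ M)
    {α : AlgebraicClosure k} (hα : α ∈ M) (hαK : α ^ p ∈ K)
    (hpow : ∀ z ∈ K ⊔ normalClosure k E (AlgebraicClosure k), z ^ p ≠ α ^ p)
    [FiniteDimensional k M] (F : Type*) [Field F] [Algebra k F] [Algebra M F] [Algebra E F]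
    [IsScalarTower k M F] [IsScalarTower k E F] [FiniteDimensional k F] : p ∣ finrank E F := by
  have : FiniteDimensional M F := .right k M F
  let j : F →ₐ[M] AlgebraicClosure k := IsAlgClosed.lift
  let jk : F →ₐ[k] AlgebraicClosure k := j.restrictScalars k
  let F' : IntermediateField E F := adjoin E {x | ∃ y : M, (y : AlgebraicClosure k) ∈ K ∧
    algebraMap M F y = x}
  have hF' (b : F) (hb : b ∈ F') : j b ∈ K ⊔ normalClosure k E (AlgebraicClosure k) := by
    induction hb using adjoin_induction with
    | mem x hx =>
      obtain ⟨y, hy, rfl⟩ := hx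
      rw [j.commutes]
      exact (le_sup_left : K ≤ _) hy
    | algebraMap x =>
      refine (le_sup_right : normalClosure k E (AlgebraicClosure k) ≤ _) ?_
      exact AlgHom.fieldRange_le_normalClosure (jk.comp (IsScalarTower.toAlgHom k E F)) ⟨x, rfl⟩
    | add x y _ _ hx hy => rw [map_add]; exact add_mem hx hy
    | inv x _ hx => rw [map_inv₀]; exact inv_mem hx
    | mul x y _ _ hx hy => rw [map_mul]; exact mul_mem hx hy
  let c : F' := ⟨algebraMap M F ⟨α ^ p, hKM hαK⟩, subset_adjoin E _ ⟨_, hαK, rfl⟩⟩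
  have hc : ∀ b : F', b ^ p ≠ c := by
    intro b hb
    refine hpow _ (hF' b b.2) ?_
    have h1 : (b : F) ^ p = algebraMap M F ⟨α ^ p, hKM hαK⟩ := congrArg Subtype.val hb
    rw [← map_pow, h1, j.commutes]
    rfl
  have hx : (algebraMap M F ⟨α, hα⟩) ^ p = algebraMap F' F c := by
    rw [← map_pow]
    rfl
  have hdeg := finrank_adjoin_of_pow_eq hp hc hx
  rw [← finrank_mul_finrank E F' F, ← finrank_mul_finrank F' F'⟮algebraMap M F ⟨α, hα⟩⟯ F, hdeg]
  exact (dvd_mul_right _ _).mul_left _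

theorem exists_extension_dvd_finrank (p : ℕ) [Fact p.Prime] [Algebra ℚ_[p] k]
    [FiniteDimensional ℚ_[p] k] [FiniteDimensional k E] :
    ∃ (M : IntermediateField k (AlgebraicClosure k)) (m : ℕ), FiniteDimensional k M ∧
      finrank k M = m * p ∧ m.Coprime p ∧ ∀ (F : Type w) [Field F] [Algebra k F] [Algebra M F]
        [Algebra E F] [IsScalarTower k M F] [IsScalarTower k E F] [FiniteDimensional k F],
        p ∣ finrank E F := by
  have hp : p.Prime := Fact.out
  have : CharZero k := charZero_of_injective_algebraMap (algebraMap ℚ_[p] k).injective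
  set N := normalClosure k E (AlgebraicClosure k) with hN
  obtain ⟨K, hK, hcop, ⟨ζ, hζ⟩, a, ha0, ha⟩ :=
    exists_coprime_extension (p := p) k (finrank k N + 1)
  have : CharZero K := charZero_of_injective_algebraMap (algebraMap k K).injective
  let L := extendScalars (le_sup_left : K ≤ K ⊔ N)
  have : FiniteDimensional k L := inferInstanceAs (FiniteDimensional k ↥(K ⊔ N))
  have : FiniteDimensional K L := .right k K L
  have hL : finrank K L < finrank k N + 1 := by
    have h1 : finrank k K * finrank K L = finrank k L := finrank_mul_finrank k K L
    have h2 : finrank k L ≤ finrank k K * finrank k N := finrank_sup_le K N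
    rw [← h1] at h2
    exact Nat.lt_succ_of_le (Nat.le_of_mul_le_mul_left h2 finrank_pos)
  obtain ⟨i, hi⟩ := exists_not_pow (L := L) hp hζ hL (a := fun i => a i) (fun i => ha0 i)
    fun i j hij => ha i j hij j.2
  obtain ⟨α, hα⟩ := IsAlgClosed.exists_pow_nat_eq
    (algebraMap K (AlgebraicClosure k) (a i)) hp.pos
  have hdeg := finrank_adjoin_of_pow_eq hp (a := a i) (fun b hb => hi (algebraMap K L b)
    (by rw [← map_pow, hb])) hα
  have hfin : FiniteDimensional K K⟮α⟯ := .of_finrank_pos (by rw [hdeg]; exact hp.pos)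
  have hfin' : FiniteDimensional k K⟮α⟯ := .trans k K K⟮α⟯
  have hM : FiniteDimensional k (IntermediateField.restrictScalars k K⟮α⟯) := hfin'
  refine ⟨IntermediateField.restrictScalars k K⟮α⟯, finrank k K, hM, ?_, hcop,
    fun F _ _ _ _ _ _ _ => ?_⟩
  · rw [← hdeg]
    exact (finrank_mul_finrank k K K⟮α⟯).symm
  · refine dvd_finrank_of_pow_mem (E := E) hp (K := K)
      (M := IntermediateField.restrictScalars k K⟮α⟯) (fun x hx => K⟮α⟯.algebraMap_mem ⟨x, hx⟩)
      (mem_adjoin_simple_self K α) (by rw [hα]; exact (a i).2) (fun z hz hzα => ?_) F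
    exact hi ⟨z, hz⟩ (Subtype.ext (hzα.trans hα))

end Composite

theorem split_of_dvd_finrank_of_tower {p : ℕ} [Fact p.Prime] (k E F D : Type*) [Field k]
    [Algebra ℚ_[p] k] [FiniteDimensional ℚ_[p] k] [Field E] [Algebra k E] [FiniteDimensional k E]
    [Field F] [Algebra k F] [Algebra E F] [IsScalarTower k E F] [FiniteDimensional k F]
    [DivisionRing D] [Algebra E D] [Algebra.IsCentral E D] (hD : finrank E D = p ^ 2)
    (hF : p ∣ finrank E F) : Nonempty ((F ⊗[E] D) ≃ₐ[F] Matrix (Fin p) (Fin p) F) := by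
  have : FiniteDimensional E F := .right k E F
  let _ : Algebra ℚ_[p] E := ((algebraMap k E).comp (algebraMap ℚ_[p] k)).toAlgebra
  have : IsScalarTower ℚ_[p] k E := .of_algebraMap_eq fun _ => rfl
  have : FiniteDimensional ℚ_[p] E := .trans ℚ_[p] k E
  exact split_of_dvd_finrank ℚ_[p] E F D Fact.out hD hF

theorem finiteDimensional_of_surjective_productMap {k : Type*} [Field k] (E M F : Type*) [Field E]
    [Algebra k E] [FiniteDimensional k E] [Field M] [Algebra k M] [FiniteDimensional k M] [Field F]
    [Algebra k F] [Algebra M F] [Algebra E F] [IsScalarTower k M F] [IsScalarTower k E F]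
    (h : Function.Surjective (Algebra.TensorProduct.productMap
      (IsScalarTower.toAlgHom k M F) (IsScalarTower.toAlgHom k E F))) : FiniteDimensional k F :=
  Module.Finite.of_surjective (Algebra.TensorProduct.productMap
    (IsScalarTower.toAlgHom k M F) (IsScalarTower.toAlgHom k E F)).toLinearMap h

end LocalDivisionRing

theorem gcd_univ_fin_two (f : Fin 2 → ℕ) : Finset.univ.gcd f = Nat.gcd (f 0) (f 1) := by
  simp [Fin.univ_succ, Finset.gcd_insert, gcd_eq_nat_gcd]

/-- Let `k` be a `p`-adic field and `E/k` a finite extension into which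
every degree-`p` extension of `k` embeds over `k`. Let `D` be a central division algebra of
degree `p` over `E` (so `dim_E D = p²`). Then there are finitely many finite field extensions
`M₁, …, M_r` of `k` such that `D ⊗_E (M_i ⊗_k E)` is split for each `i` and
`gcd([M₁ : k], …, [M_r : k]) = p`. (So the corresponding `R_{E/k}(PGL_p)`-torsor admits a
zero-cycle of degree `p`.) -/
theorem statement10 (p : ℕ) [Fact p.Prime] (k : Type) [Field k]
    [Algebra ℚ_[p] k] [FiniteDimensional ℚ_[p] k]
    (E : Type) [Field E] [Algebra k E] [FiniteDimensional k E]
    (hE : ∀ (F : Type) [Field F] [Algebra k F], FiniteDimensional k F →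
      finrank k F = p → Nonempty (F →ₐ[k] E))
    (D : Type) [DivisionRing D] [Algebra E D] [Algebra.IsCentral E D]
    (hD : finrank E D = p ^ 2) :
    ∃ (r : ℕ) (M : Fin r → IntermediateField k (AlgebraicClosure k)),
      (∀ i, FiniteDimensional k (M i)) ∧
      (∀ i, CSASplitsOver k E D p (M i)) ∧
      Finset.univ.gcd (fun i => finrank k (M i)) = p := by
  have hp : p.Prime := Fact.out
  obtain ⟨M₁, m, hM₁, hdeg₁, hcop, hdvd₁⟩ :=
    LocalDivisionRing.exists_extension_dvd_finrank.{0} (k := k) (E := E) p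
  obtain ⟨M₂, hM₂, hdeg₂⟩ :=
    LocalDivisionRing.exists_ramified_extension (p := p) k (finrank k E)
  have hpos : 0 < finrank k E := finrank_pos
  have hsplit (F : Type) [Field F] [Algebra k F] [Algebra E F] [IsScalarTower k E F]
      [FiniteDimensional k F] (h : p ∣ finrank E F) :
      Nonempty ((F ⊗[E] D) ≃ₐ[F] Matrix (Fin p) (Fin p) F) :=
    LocalDivisionRing.split_of_dvd_finrank_of_tower k E F D hD h
  have hs₁ : CSASplitsOver k E D p M₁ := by
    intro F _ _ _ _ _ _ hF
    have := LocalDivisionRing.finiteDimensional_of_surjective_productMap E M₁ F hF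
    exact hsplit F (hdvd₁ F)
  have hs₂ : CSASplitsOver k E D p M₂ := by
    intro F _ _ _ _ _ _ hF
    have := LocalDivisionRing.finiteDimensional_of_surjective_productMap E M₂ F hF
    refine hsplit F (by_contra fun h => ?_)
    have h1 : p ^ finrank k E ∣ finrank k E * finrank E F := by
      rw [finrank_mul_finrank k E F, ← finrank_mul_finrank k M₂ F, ← hdeg₂]
      exact dvd_mul_right _ _
    have h2 := (((Nat.Prime.coprime_iff_not_dvd hp).2 h).pow_left _).dvd_of_dvd_mul_right h1
    exact absurd (Nat.le_of_dvd hpos h2) (not_le.2 (Nat.lt_pow_self hp.one_lt))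
  refine ⟨2, ![M₁, M₂], Fin.forall_fin_two.2 ⟨hM₁, hM₂⟩, Fin.forall_fin_two.2 ⟨hs₁, hs₂⟩, ?_⟩
  have hgcd : Nat.gcd (m * p) (p ^ finrank k E) = p := by
    obtain ⟨n, hn⟩ : ∃ n, finrank k E = n + 1 := ⟨_, (Nat.sub_add_cancel hpos).symm⟩
    rw [hn, pow_succ, Nat.gcd_mul_right, (Nat.Coprime.pow_right n hcop), one_mul]
  rw [← hdeg₁, ← hdeg₂] at hgcd
  exact (gcd_univ_fin_two _).trans hgcd
end

section
/- Let E = Q₂(√2, √3, √5) be the field obtained from the 2-adic numbers Q₂ by adjoining square roots of 2, 3, and 5. Then [E : Q₂] = 8, and every field extension of Q₂ of degree 2 admits a Q₂-embedding into E. -/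
open Polynomial

/-- `E = ℚ₂(√2, √3, √5)`: the splitting field over the `2`-adic numbers `ℚ₂` of the
polynomial `(X² − 2)(X² − 3)(X² − 5)`. -/
noncomputable def QtwoSqrt235 : Type :=
  ((X ^ 2 - C 2) * (X ^ 2 - C 3) * (X ^ 2 - C 5) : ℚ_[2][X]).SplittingField

noncomputable instance : Field QtwoSqrt235 :=
  inferInstanceAs (Field ((X ^ 2 - C 2) * (X ^ 2 - C 3) * (X ^ 2 - C 5) : ℚ_[2][X]).SplittingField)

noncomputable instance : Algebra ℚ_[2] QtwoSqrt235 :=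
  inferInstanceAs (Algebra ℚ_[2]
    ((X ^ 2 - C 2) * (X ^ 2 - C 3) * (X ^ 2 - C 5) : ℚ_[2][X]).SplittingField)

/-- A `2`-adic integer congruent to `1` modulo `8` is a square. -/
lemma PadicInt.isSquare_of_toZModPow_three_eq_one {u : ℤ_[2]} (hu : toZModPow 3 u = 1) :
    IsSquare u := by
  have hmem : 1 - u ∈ Ideal.span {((2 : ℕ) : ℤ_[2]) ^ 3} := by
    rw [← ker_toZModPow, RingHom.mem_ker, map_sub, hu, map_one, sub_self]
  rw [← norm_le_pow_iff_mem_span_pow] at hmem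
  have h2 : ‖(2 : ℤ_[2])‖ = 2⁻¹ := by simpa using PadicInt.norm_p (p := 2)
  obtain ⟨z, hz, -⟩ := hensels_lemma (p := 2) (F := (X ^ 2 - C u : ℤ_[2][X])) (a := (1 : ℤ_[2])) (by
    have h : ‖(1 - u : ℤ_[2])‖ < (2⁻¹ : ℝ) ^ 2 := hmem.trans_lt (by norm_num)
    have hderiv : ‖((X ^ 2 - C u : ℤ_[2][X]).derivative.aeval 1 : ℤ_[2])‖ = 2⁻¹ := by
      simpa [one_add_one_eq_two] using h2
    rw [hderiv]
    simpa using h)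
  exact ⟨z, by simpa [sub_eq_zero, sq, eq_comm] using hz⟩

/-- Every odd residue modulo `8` is inverse to the class of `1`, `3`, `5` or `15`. -/
lemma PadicInt.exists_isSquare_mul_of_isUnit {u : ℤ_[2]} (hu : IsUnit u) :
    IsSquare u ∨ IsSquare (u * 3) ∨ IsSquare (u * 5) ∨ IsSquare (u * (3 * 5)) := by
  have h : ∀ a : ZMod (2 ^ 3), IsUnit a → a = 1 ∨ a * 3 = 1 ∨ a * 5 = 1 ∨ a * (3 * 5) = 1 := by
    decide
  refine (h _ (hu.map (toZModPow 3))).imp isSquare_of_toZModPow_three_eq_one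
    (Or.imp ?_ (Or.imp ?_ ?_)) <;>
  · intro h
    refine isSquare_of_toZModPow_three_eq_one ?_
    simpa only [map_mul, map_ofNat] using h

/-- The square classes of `ℚ₂` are generated by `2`, `3` and `5`. -/
lemma Padic.isSquare_map_of_isSquare_two_three_five {E : Type*} [Field E] [CharZero E]
    (φ : ℚ_[2] →+* E) (h2 : IsSquare (2 : E)) (h3 : IsSquare (3 : E)) (h5 : IsSquare (5 : E))
    (x : ℚ_[2]) : IsSquare (φ x) := by
  let ψ : ℤ_[2] →+* E := φ.comp PadicInt.Coe.ringHom
  have hint (a : ℤ_[2]) : IsSquare (ψ a) := by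
    rcases eq_or_ne a 0 with rfl | ha
    · simp
    have of_mul {u : ℤ_[2]} {d : E} (hd : d ≠ 0) (hsq : IsSquare d)
        (h : IsSquare (ψ u * d)) : IsSquare (ψ u) := by
      simpa [hd] using h.div hsq
    have hunit : IsSquare (ψ (PadicInt.unitCoeff ha)) := by
      rcases PadicInt.exists_isSquare_mul_of_isUnit (PadicInt.unitCoeff ha).isUnit
        with h | h | h | h
      · exact h.map ψ
      · exact of_mul three_ne_zero h3 (by simpa only [map_mul, map_ofNat] using h.map ψ)
      · exact of_mul (OfNat.ofNat_ne_zero 5) h5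
          (by simpa only [map_mul, map_ofNat] using h.map ψ)
      · exact of_mul (mul_ne_zero three_ne_zero (OfNat.ofNat_ne_zero 5)) (h3.mul h5)
          (by simpa only [map_mul, map_ofNat] using h.map ψ)
    rw [PadicInt.unitCoeff_spec ha]
    simpa only [map_mul, map_pow, Nat.cast_ofNat, map_ofNat] using hunit.mul (h2.pow a.valuation)
  obtain ⟨a, b, -, rfl⟩ := IsFractionRing.div_surjective (A := ℤ_[2]) x
  rw [map_div₀]
  exact (hint a).div (hint b)

lemma Padic.not_isSquare_natCast {n : ℕ} (hn : ¬ IsSquare (n : ZMod (2 ^ 4))) :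
    ¬ IsSquare (n : ℚ_[2]) := by
  rintro ⟨x, hx⟩
  have hx1 : ‖x‖ ≤ 1 := by
    have h : ‖(n : ℚ_[2])‖ ≤ 1 := by simpa using Padic.norm_int_le_one (p := 2) n
    rw [hx, norm_mul] at h
    nlinarith [norm_nonneg x]
  obtain ⟨x, rfl⟩ : ∃ y : ℤ_[2], (y : ℚ_[2]) = x := ⟨⟨x, hx1⟩, rfl⟩
  have hy : (n : ℤ_[2]) = x * x := PadicInt.ext (by simpa using hx)
  exact hn ⟨PadicInt.toZModPow 4 x, by rw [← map_mul, ← hy, map_natCast]⟩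

namespace IntermediateField

variable {K E : Type*} [Field K] [Field E] [Algebra K E]

lemma exists_add_mul_of_mem_sup_of_sq_mem (F : IntermediateField K E) {s x : E}
    (hs : s ^ 2 ∈ F) (hx : x ∈ F ⊔ K⟮s⟯) : ∃ a ∈ F, ∃ b ∈ F, x = a + b * s := by
  have hint : IsAlgebraic F s :=
    (IsIntegral.of_pow two_pos (isIntegral_algebraMap (x := (⟨s ^ 2, hs⟩ : F)))).isAlgebraic
  rw [← restrictScalars_adjoin_eq_sup, mem_restrictScalars, ← mem_toSubalgebra,
    adjoin_simple_toSubalgebra_of_isAlgebraic hint] at hx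
  induction hx using Algebra.adjoin_induction with
  | mem x hx =>
    rw [Set.mem_singleton_iff.1 hx]
    exact ⟨0, F.zero_mem, 1, F.one_mem, by ring⟩
  | algebraMap r => exact ⟨r, r.2, 0, F.zero_mem, by simp [algebraMap_apply]⟩
  | add x y _ _ hx hy =>
    obtain ⟨a, ha, b, hb, rfl⟩ := hx
    obtain ⟨c, hc, d, hd, rfl⟩ := hy
    exact ⟨a + c, F.add_mem ha hc, b + d, F.add_mem hb hd, by ring⟩
  | mul x y _ _ hx hy =>
    obtain ⟨a, ha, b, hb, rfl⟩ := hx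
    obtain ⟨c, hc, d, hd, rfl⟩ := hy
    exact ⟨a * c + b * d * s ^ 2, F.add_mem (F.mul_mem ha hc) (F.mul_mem (F.mul_mem hb hd) hs),
      a * d + b * c, F.add_mem (F.mul_mem ha hd) (F.mul_mem hb hc), by ring⟩

lemma mem_or_mul_mem_of_mem_sup_of_sq_mem [NeZero (2 : E)] (F : IntermediateField K E)
    {s x : E} (hs : s ^ 2 ∈ F) (hx2 : x ^ 2 ∈ F) (hx : x ∈ F ⊔ K⟮s⟯) : x ∈ F ∨ x * s ∈ F := by
  obtain ⟨a, ha, b, hb, rfl⟩ := F.exists_add_mul_of_mem_sup_of_sq_mem hs hx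
  rcases eq_or_ne a 0 with rfl | ha0
  · right
    rw [zero_add, mul_assoc, ← sq]
    exact F.mul_mem hb hs
  left
  rcases eq_or_ne b 0 with rfl | hb0
  · simpa using ha
  have h2 : (2 : E) ≠ 0 := two_ne_zero
  have hsF : s = ((a + b * s) ^ 2 - a ^ 2 - b ^ 2 * s ^ 2) / (2 * a * b) := by
    field_simp
    ring
  refine F.add_mem ha (F.mul_mem hb ?_)
  rw [hsF]
  exact F.div_mem (F.sub_mem (F.sub_mem hx2 (pow_mem ha 2)) (F.mul_mem (pow_mem hb 2) hs))
    (F.mul_mem (F.mul_mem (ofNat_mem F 2) ha) hb)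

lemma finrank_sup_adjoin_simple_of_sq_mem (F : IntermediateField K E) {s : E}
    (hs : s ^ 2 ∈ F) (hsF : s ∉ F) :
    Module.finrank K ↥(F ⊔ K⟮s⟯) = Module.finrank K F * 2 := by
  have hint : IsIntegral F s :=
    IsIntegral.of_pow two_pos (isIntegral_algebraMap (x := (⟨s ^ 2, hs⟩ : F)))
  have hdeg : (minpoly F s).natDegree = 2 := by
    refine le_antisymm ?_ ((minpoly.two_le_natDegree_iff hint).2 ?_)
    · have h := minpoly.min F s (monic_X_pow_sub_C (⟨s ^ 2, hs⟩ : F) two_ne_zero)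
        (by simp [algebraMap_apply])
      simpa using natDegree_le_natDegree h
    · rintro ⟨y, rfl⟩
      exact hsF y.2
  have h : Module.finrank F F⟮s⟯ = 2 := by rw [adjoin.finrank hint, hdeg]
  rw [← h, ← restrictScalars_adjoin_eq_sup]
  exact (Module.finrank_mul_finrank K F F⟮s⟯).symm

end IntermediateField

lemma isSquare_of_sq_eq_algebraMap_of_mem_bot {K E : Type*} [Field K] [Field E] [Algebra K E]
    {a : K} {x : E} (hx : x ^ 2 = algebraMap K E a) (h : x ∈ (⊥ : IntermediateField K E)) :
    IsSquare a := by
  obtain ⟨y, rfl⟩ := IntermediateField.mem_bot.1 h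
  refine ⟨y, (algebraMap K E).injective ?_⟩
  rw [← hx, map_mul, sq]

open IntermediateField in
/-- Adjoining square roots of three elements that are independent modulo squares gives an
extension of degree `8`. -/
lemma finrank_adjoin_three_sqrt {K E : Type*} [Field K] [Field E] [Algebra K E] [NeZero (2 : E)]
    {a b c : K} {r s t : E} (hr : r ^ 2 = algebraMap K E a) (hs : s ^ 2 = algebraMap K E b)
    (ht : t ^ 2 = algebraMap K E c) (ha : ¬ IsSquare a) (hb : ¬ IsSquare b)
    (hab : ¬ IsSquare (b * a)) (hc : ¬ IsSquare c) (hca : ¬ IsSquare (c * a))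
    (hcb : ¬ IsSquare (c * b)) (hcba : ¬ IsSquare (c * b * a)) :
    Module.finrank K ↥(K⟮r⟯ ⊔ K⟮s⟯ ⊔ K⟮t⟯) = 8 := by
  have sq_mem (F : IntermediateField K E) {x : E} {k : K}
      (hx : x ^ 2 = algebraMap K E k) : x ^ 2 ∈ F := hx ▸ F.algebraMap_mem k
  have not_mem_adjoin {x : E} {k : K} (hx : x ^ 2 = algebraMap K E k) (hk : ¬ IsSquare k)
      (hka : ¬ IsSquare (k * a)) : x ∉ K⟮r⟯ := fun h ↦
    (mem_or_mul_mem_of_mem_sup_of_sq_mem ⊥ (sq_mem _ hr) (sq_mem _ hx) (by rwa [bot_sup_eq])).elim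
      (fun h ↦ hk (isSquare_of_sq_eq_algebraMap_of_mem_bot hx h))
      (fun h ↦ hka (isSquare_of_sq_eq_algebraMap_of_mem_bot
        (by rw [mul_pow, hx, hr, map_mul]) h))
  rw [finrank_sup_adjoin_simple_of_sq_mem _ (sq_mem _ ht),
    finrank_sup_adjoin_simple_of_sq_mem _ (sq_mem _ hs) (not_mem_adjoin hs hb hab),
    ← bot_sup_eq K⟮r⟯, finrank_sup_adjoin_simple_of_sq_mem _ (sq_mem _ hr)
      (fun h ↦ ha (isSquare_of_sq_eq_algebraMap_of_mem_bot hr h)), IntermediateField.finrank_bot]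
  intro h
  rcases mem_or_mul_mem_of_mem_sup_of_sq_mem _ (sq_mem _ hs) (sq_mem _ ht) h with h | h
  · exact not_mem_adjoin ht hc hca h
  · exact not_mem_adjoin (by rw [mul_pow, ht, hs, map_mul]) hcb hcba h

/-- A quadratic extension of `K` embeds into any extension of `K` in which all elements of `K`
become squares. -/
lemma nonempty_algHom_of_finrank_eq_two {K F E : Type*} [Field K] [Field F] [Field E]
    [Algebra K F] [Algebra K E] [NeZero (2 : E)] (hsq : ∀ x : K, IsSquare (algebraMap K E x))
    (hF : Module.finrank K F = 2) : Nonempty (F →ₐ[K] E) := by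
  have : FiniteDimensional K F := .of_finrank_pos (by omega)
  refine IntermediateField.nonempty_algHom_of_splits fun s ↦ ⟨.of_finite K s, ?_⟩
  set p := (minpoly K s).map (algebraMap K E) with hp
  have hle : p.natDegree ≤ 2 := natDegree_map_le.trans (hF ▸ minpoly.natDegree_le s)
  rcases hle.lt_or_eq with h | h
  · exact .of_natDegree_le_one (by omega)
  have hlead : p.coeff 2 ≠ 0 := by
    rw [← h]
    exact leadingCoeff_ne_zero.2 (ne_zero_of_natDegree_gt (n := 0) (by omega))
  obtain ⟨d, hd⟩ := hsq (discrim ((minpoly K s).coeff 2) ((minpoly K s).coeff 1)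
    ((minpoly K s).coeff 0))
  obtain ⟨x, hx⟩ := exists_quadratic_eq_zero (a := p.coeff 2) (b := p.coeff 1) (c := p.coeff 0)
    hlead ⟨d, by
      simpa only [discrim, hp, coeff_map, map_sub, map_mul, map_pow, map_ofNat] using hd⟩
  refine .of_natDegree_eq_two (x := x) h ?_
  rw [eval_eq_sum_range, h]
  simp only [Finset.sum_range_succ, Finset.sum_range_zero]
  linear_combination hx

/-- Let `E = ℚ₂(√2, √3, √5)`. Then `[E : ℚ₂] = 8` and every field extension
of `ℚ₂` of degree `2` admits a `ℚ₂`-embedding into `E`. -/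
theorem statement11 :
    Module.finrank ℚ_[2] QtwoSqrt235 = 8 ∧
    ∀ (F : Type) [Field F] [Algebra ℚ_[2] F], Module.finrank ℚ_[2] F = 2 →
      Nonempty (F →ₐ[ℚ_[2]] QtwoSqrt235) := by
  let f : ℚ_[2][X] := (X ^ 2 - C 2) * (X ^ 2 - C 3) * (X ^ 2 - C 5)
  have hsf : f.IsSplittingField ℚ_[2] QtwoSqrt235 :=
    inferInstanceAs (f.IsSplittingField ℚ_[2] f.SplittingField)
  have : CharZero QtwoSqrt235 := charZero_of_injective_algebraMap (algebraMap ℚ_[2] _).injective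
  have hf : f ≠ 0 := by
    refine mul_ne_zero (mul_ne_zero ?_ ?_) ?_ <;> exact X_pow_sub_C_ne_zero two_pos _
  have hroot (n : ℚ_[2]) (hn : X ^ 2 - C n ∣ f) :
      ∃ r : QtwoSqrt235, r ^ 2 = algebraMap ℚ_[2] QtwoSqrt235 n := by
    have hs := hsf.splits'.of_dvd (map_ne_zero hf) (map_dvd (mapRingHom _) hn)
    obtain ⟨r, hr⟩ := hs.exists_eval_eq_zero (by simp [degree_X_pow_sub_C two_pos])
    exact ⟨r, by simpa [sub_eq_zero] using hr⟩
  obtain ⟨r, hr⟩ := hroot 2 ⟨_, mul_assoc _ _ _⟩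
  obtain ⟨s, hs⟩ := hroot 3 ⟨(X ^ 2 - C 2) * (X ^ 2 - C 5), by ring⟩
  obtain ⟨t, ht⟩ := hroot 5 ⟨_, mul_comm _ _⟩
  have htop : IntermediateField.adjoin ℚ_[2] {r} ⊔ IntermediateField.adjoin ℚ_[2] {s} ⊔
      IntermediateField.adjoin ℚ_[2] {t} = ⊤ := by
    have mem_of_sq_eq {x y : QtwoSqrt235} {n : ℚ_[2]} {F : IntermediateField ℚ_[2] QtwoSqrt235}
        (hx : x ^ 2 - algebraMap ℚ_[2] QtwoSqrt235 n = 0)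
        (hy : y ^ 2 = algebraMap ℚ_[2] QtwoSqrt235 n)
        (hF : IntermediateField.adjoin ℚ_[2] {y} ≤ F) : x ∈ F := by
      have hyF : y ∈ F := hF (IntermediateField.mem_adjoin_simple_self _ y)
      rcases sq_eq_sq_iff_eq_or_eq_neg.1 ((sub_eq_zero.1 hx).trans hy.symm) with rfl | rfl
      · exact hyF
      · exact F.neg_mem hyF
    rw [← IntermediateField.toSubalgebra_inj, IntermediateField.top_toSubalgebra, eq_top_iff,
      ← hsf.adjoin_rootSet', Algebra.adjoin_le_iff]
    intro x hx
    have hx0 := (mem_rootSet.1 hx).2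
    simp only [f, map_mul, map_sub, map_pow, aeval_X, aeval_C, mul_eq_zero] at hx0
    rcases hx0 with (h | h) | h
    · exact mem_of_sq_eq h hr (le_sup_left.trans le_sup_left)
    · exact mem_of_sq_eq h hs (le_sup_right.trans le_sup_left)
    · exact mem_of_sq_eq h ht le_sup_right
  refine ⟨?_, fun F _ _ hF ↦ nonempty_algHom_of_finrank_eq_two
    (Padic.isSquare_map_of_isSquare_two_three_five _ ⟨r, ?_⟩ ⟨s, ?_⟩ ⟨t, ?_⟩) hF⟩
  · rw [← IntermediateField.finrank_top', ← htop]
    apply finrank_adjoin_three_sqrt hr hs ht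
    · exact_mod_cast Padic.not_isSquare_natCast (n := 2) (by decide)
    · exact_mod_cast Padic.not_isSquare_natCast (n := 3) (by decide)
    · exact_mod_cast Padic.not_isSquare_natCast (n := 3 * 2) (by decide)
    · exact_mod_cast Padic.not_isSquare_natCast (n := 5) (by decide)
    · exact_mod_cast Padic.not_isSquare_natCast (n := 5 * 2) (by decide)
    · exact_mod_cast Padic.not_isSquare_natCast (n := 5 * 3) (by decide)
    · exact_mod_cast Padic.not_isSquare_natCast (n := 5 * 3 * 2) (by decide)
  · rw [← sq, hr, map_ofNat]
  · rw [← sq, hs, map_ofNat]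
  · rw [← sq, ht, map_ofNat]
end
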